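/- arXiv:1611.07693 — 16 statements merged into one kernel-verified Lean document; each statement's English description precedes it below -/
import Mathlib

section
/- For every i ≥ 0 there is an isomorphism of abelian groups H_{2i+1} ≅ ℤ ⊕ ⊕_{n∈ℤ∖{0}} ℤ/|n|ℤ (equivalently, ℤ ⊕ ⊕_{n≥2}(ℤ/nℤ ⊕ ℤ/nℤ)); here the ℤ summand is generated by e(1⊗1) and the ℤ/|n|ℤ summand by e(1⊗x^n) (this is the computation H_{2i+1}^{S^1}(LS^1) of Theorem 3.1(1)). -/
/-- The projection of `⊕_{n∈ℤ} ℤ` onto `ℤ ⊕ ⊕_{n≠0} ℤ/|n|ℤ` reducing the `n`-th coordinate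
modulo `n`. -/
noncomputable def coordinateReduction :
    (ℤ →₀ ℤ) →+ ℤ × DirectSum {m : ℤ // m ≠ 0} (fun m => ZMod m.1.natAbs) :=
  Finsupp.liftAddHom fun m =>
    if h : m = 0 then AddMonoidHom.inl _ _
    else (AddMonoidHom.inr _ _).comp
      ((DirectSum.of (fun m : {m : ℤ // m ≠ 0} => ZMod m.1.natAbs) ⟨m, h⟩).comp
        (Int.castAddHom _))

lemma coordinateReduction_single_zero (k : ℤ) :
    coordinateReduction (Finsupp.single 0 k) = (k, 0) := by
  simp [coordinateReduction]

lemma coordinateReduction_single (m : {m : ℤ // m ≠ 0}) (k : ℤ) :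
    coordinateReduction (Finsupp.single m.1 k) =
      (0, DirectSum.of (fun m : {m : ℤ // m ≠ 0} => ZMod m.1.natAbs) m (k : ZMod _)) := by
  simp [coordinateReduction, m.2]

lemma coordinateReduction_fst (f : ℤ →₀ ℤ) : (coordinateReduction f).1 = f 0 := by
  induction f using Finsupp.induction_linear with
  | zero => simp
  | add f g hf hg => simp [hf, hg]
  | single m k =>
    by_cases h : m = 0
    · subst h
      simp [coordinateReduction_single_zero]
    · simp [coordinateReduction_single ⟨m, h⟩, h]

lemma coordinateReduction_snd (f : ℤ →₀ ℤ) (m : {m : ℤ // m ≠ 0}) :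
    (coordinateReduction f).2 m = (f m : ZMod m.1.natAbs) := by
  induction f using Finsupp.induction_linear with
  | zero => simp
  | add f g hf hg => simp [hf, hg]
  | single n k =>
    by_cases h : n = 0
    · subst h
      simp [coordinateReduction_single_zero, m.2.symm]
    · rw [coordinateReduction_single ⟨n, h⟩]
      by_cases hnm : (⟨n, h⟩ : {m : ℤ // m ≠ 0}) = m
      · subst hnm
        simp
      · have hne : n ≠ m.1 := fun h' => hnm (Subtype.ext h')
        simp [DirectSum.of_eq_of_ne _ _ _ (Ne.symm hnm), hne]

lemma coordinateReduction_surjective : Function.Surjective coordinateReduction := by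
  rintro ⟨k, d⟩
  obtain ⟨f, hf⟩ : ∃ f, coordinateReduction f = (0, d) := by
    induction d using DirectSum.induction_on with
    | zero => exact ⟨0, map_zero _⟩
    | of m z =>
      obtain ⟨k, rfl⟩ := ZMod.intCast_surjective z
      exact ⟨_, coordinateReduction_single m k⟩
    | add x y hx hy =>
      obtain ⟨f, hf⟩ := hx
      obtain ⟨g, hg⟩ := hy
      exact ⟨f + g, by simp [hf, hg]⟩
  exact ⟨Finsupp.single 0 k + f, by simp [coordinateReduction_single_zero, hf]⟩

lemma mem_ker_coordinateReduction (f : ℤ →₀ ℤ) :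
    f ∈ coordinateReduction.ker ↔ ∀ m, m ∣ f m := by
  have key (m : {m : ℤ // m ≠ 0}) : (coordinateReduction f).2 m = 0 ↔ m.1 ∣ f m := by
    rw [coordinateReduction_snd, ZMod.intCast_zmod_eq_zero_iff_dvd, Int.natAbs_dvd]
  rw [AddMonoidHom.mem_ker]
  constructor
  · intro hf m
    by_cases h : m = 0
    · subst h
      rw [← coordinateReduction_fst, hf]
      simp
    · exact (key ⟨m, h⟩).1 (by rw [hf]; rfl)
  · intro hf
    refine Prod.ext ?_ (DFinsupp.ext fun m => (key m).2 (hf m))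
    rw [coordinateReduction_fst]
    exact zero_dvd_iff.1 (hf 0)

lemma mem_range_iff_forall_dvd {Δ : (ℤ →₀ ℤ) →+ (ℤ →₀ ℤ)}
    (hΔ : ∀ m, Δ (Finsupp.single m 1) = Finsupp.single m m) (f : ℤ →₀ ℤ) :
    f ∈ Δ.range ↔ ∀ m, m ∣ f m := by
  have key (g : ℤ →₀ ℤ) (m : ℤ) : Δ g m = m * g m := by
    induction g using Finsupp.induction_linear with
    | zero => simp
    | add f g hf hg => simp [hf, hg, mul_add]
    | single n k =>
      have : Finsupp.single n k = k • Finsupp.single n (1 : ℤ) := by simp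
      rw [this, map_zsmul, hΔ]
      by_cases h : n = m
      · subst h
        simp [mul_comm]
      · simp [h]
  constructor
  · rintro ⟨g, rfl⟩ m
    exact ⟨g m, key g m⟩
  · intro hf
    refine ⟨Finsupp.onFinset f.support (fun m => f m / m) fun m hm => ?_, ?_⟩
    · rw [Finsupp.mem_support_iff]
      intro h
      simp [h] at hm
    · ext m
      rw [key]
      exact Int.mul_ediv_cancel' (hf m)


/-- For every `i ≥ 0`, `H_{2i+1} = H_{2i+1}^{S¹}(LS¹) ≅ ℤ ⊕ ⊕_{n∈ℤ∖{0}} ℤ/|n|ℤ`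
(Theorem 3.1(1), odd degrees). -/
theorem stmt1
    (H : ℤ → Type) [∀ i, AddCommGroup (H i)]
    -- H_i = 0 in negative degrees
    (hneg : ∀ i : ℤ, i < 0 → ∀ x : H i, x = 0)
    -- erasing maps: e₀ : ℍ₋₁ = ⊕_{n∈ℤ} ℤ·(a⊗xⁿ) → H₀ and e₁ : ℍ₀ = ⊕_{n∈ℤ} ℤ·(1⊗xⁿ) → H₁
    (e0 : (ℤ →₀ ℤ) →+ H 0)
    (e1 : (ℤ →₀ ℤ) →+ H 1)
    -- cap product with the Euler class; c i j is only meaningful when j = i - 2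
    (c : ∀ i j : ℤ, H i →+ H j)
    -- marking map M₀ : H₀ → ℍ₀ (the only degree where ℍ is nonzero in the image of M)
    (M0 : H 0 →+ (ℤ →₀ ℤ))
    -- exactness of ⋯ → ℍ_{i-1} → H_i → H_{i-2} → ℍ_{i-2} → H_{i-1} → ⋯ :
    (he0_inj : Function.Injective e0)
    (he0c : AddMonoidHom.range e0 = AddMonoidHom.ker (c 0 (-2)))
    (hc20 : AddMonoidHom.range (c 2 0) = AddMonoidHom.ker M0)
    (hkere1 : AddMonoidHom.ker e1 = AddMonoidHom.range M0)
    (he1c : AddMonoidHom.range e1 = AddMonoidHom.ker (c 1 (-1)))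
    (hcinj : ∀ i : ℤ, 2 ≤ i → Function.Injective (c i (i - 2)))
    (hcsurj : ∀ i : ℤ, 1 ≤ i → Function.Surjective (c (i + 2) i))
    -- BV operator: M ∘ e = Δ, Δ(a⊗xⁿ) = n·(1⊗xⁿ)
    (hBV : ∀ m : ℤ, M0 (e0 (Finsupp.single m 1)) = Finsupp.single m m)
    :
    ∀ i : ℕ,
      Nonempty (H (2 * (i : ℤ) + 1) ≃+
        ℤ × DirectSum {m : ℤ // m ≠ 0} (fun m => ZMod m.1.natAbs)) := by
  have he0 : Function.Surjective e0 := fun x => by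
    rw [← AddMonoidHom.mem_range, he0c]
    exact hneg (-2) (by norm_num) _
  have he1 : Function.Surjective e1 := fun x => by
    rw [← AddMonoidHom.mem_range, he1c]
    exact hneg (-1) (by norm_num) _
  have hker : e1.ker = coordinateReduction.ker := by
    ext f
    rw [mem_ker_coordinateReduction, ← mem_range_iff_forall_dvd (Δ := M0.comp e0) hBV, hkere1]
    simp only [AddMonoidHom.mem_range, AddMonoidHom.comp_apply, he0.exists]
  have shift (j : ℤ) (hj : 1 ≤ j) : Nonempty (H (j + 2) ≃+ H j) := by
    have hinj := hcinj (j + 2) (by lia)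
    rw [add_sub_cancel_right] at hinj
    exact ⟨AddEquiv.ofBijective (c (j + 2) j) ⟨hinj, hcsurj j hj⟩⟩
  intro i
  induction i with
  | zero =>
    exact ⟨(QuotientAddGroup.quotientKerEquivOfSurjective e1 he1).symm.trans
      ((QuotientAddGroup.quotientAddEquivOfEq hker).trans
        (QuotientAddGroup.quotientKerEquivOfSurjective _ coordinateReduction_surjective))⟩
  | succ i ih =>
    obtain ⟨φ⟩ := ih
    obtain ⟨ψ⟩ := shift (2 * (i : ℤ) + 1) (by lia)
    rw [show 2 * ((i + 1 : ℕ) : ℤ) + 1 = 2 * (i : ℤ) + 1 + 2 by push_cast; ring]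
    exact ⟨ψ.trans φ⟩
end

section
/- For every i ≥ 1 there is an isomorphism of abelian groups H_{2i} ≅ ℤ (this is the computation H_{2i}^{S^1}(LS^1) ≅ ℤ of Theorem 3.1(1)). -/
/-- Two injective homomorphisms with the same range have isomorphic sources. -/
theorem nonempty_addEquiv_of_range_eq {A B C : Type*} [AddGroup A] [AddGroup B] [AddGroup C]
    {f : A →+ C} {g : B →+ C} (hf : Function.Injective f) (hg : Function.Injective g)
    (h : f.range = g.range) : Nonempty (A ≃+ B) :=
  ⟨((AddMonoidHom.ofInjective hf).trans (AddEquiv.addSubgroupCongr h)).trans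
    (AddMonoidHom.ofInjective hg).symm⟩

/-- The kernel of the diagonal operator `single m 1 ↦ single m m` is spanned by `single 0 1`. -/
theorem ker_eq_range_singleAddHom_zero (D : (ℤ →₀ ℤ) →+ (ℤ →₀ ℤ))
    (hD : ∀ m : ℤ, D (Finsupp.single m 1) = Finsupp.single m m) :
    D.ker = (Finsupp.singleAddHom (0 : ℤ) : ℤ →+ (ℤ →₀ ℤ)).range := by
  have happly : ∀ (f : ℤ →₀ ℤ) (n : ℤ), D f n = f n * n := by
    intro f n
    induction f using Finsupp.induction_linear with
    | zero => simp
    | add f g hf hg => simp [hf, hg, add_mul]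
    | single m k =>
      have hk : Finsupp.single m k = k • Finsupp.single m (1 : ℤ) := by simp
      rw [hk, map_zsmul, hD]
      by_cases hmn : m = n
      · subst hmn; simp
      · simp [hmn]
  ext f
  rw [AddMonoidHom.mem_ker, AddMonoidHom.mem_range]
  constructor
  · intro hf
    refine ⟨f 0, ?_⟩
    ext n
    by_cases hn : n = 0
    · subst hn; simp
    · have h := happly f n
      rw [hf, Finsupp.zero_apply, eq_comm, mul_eq_zero, or_iff_left hn] at h
      simp [h, Ne.symm hn]
  · rintro ⟨k, rfl⟩
    ext n
    rw [happly]
    by_cases hn : n = 0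
    · simp [hn]
    · simp [Ne.symm hn]


/-- For every `i ≥ 1`, `H_{2i} = H_{2i}^{S¹}(LS¹) ≅ ℤ` (Theorem 3.1(1), positive even degrees). -/
theorem stmt2
    (H : ℤ → Type) [∀ i, AddCommGroup (H i)]
    -- H_i = 0 in negative degrees
    (hneg : ∀ i : ℤ, i < 0 → ∀ x : H i, x = 0)
    -- erasing maps: e₀ : ℍ₋₁ = ⊕_{n∈ℤ} ℤ·(a⊗xⁿ) → H₀ and e₁ : ℍ₀ = ⊕_{n∈ℤ} ℤ·(1⊗xⁿ) → H₁
    (e0 : (ℤ →₀ ℤ) →+ H 0)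
    (e1 : (ℤ →₀ ℤ) →+ H 1)
    -- cap product with the Euler class; c i j is only meaningful when j = i - 2
    (c : ∀ i j : ℤ, H i →+ H j)
    -- marking map M₀ : H₀ → ℍ₀ (the only degree where ℍ is nonzero in the image of M)
    (M0 : H 0 →+ (ℤ →₀ ℤ))
    -- exactness of ⋯ → ℍ_{i-1} → H_i → H_{i-2} → ℍ_{i-2} → H_{i-1} → ⋯ :
    (he0_inj : Function.Injective e0)
    (he0c : AddMonoidHom.range e0 = AddMonoidHom.ker (c 0 (-2)))
    (hc20 : AddMonoidHom.range (c 2 0) = AddMonoidHom.ker M0)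
    (hkere1 : AddMonoidHom.ker e1 = AddMonoidHom.range M0)
    (he1c : AddMonoidHom.range e1 = AddMonoidHom.ker (c 1 (-1)))
    (hcinj : ∀ i : ℤ, 2 ≤ i → Function.Injective (c i (i - 2)))
    (hcsurj : ∀ i : ℤ, 1 ≤ i → Function.Surjective (c (i + 2) i))
    -- BV operator: M ∘ e = Δ, Δ(a⊗xⁿ) = n·(1⊗xⁿ)
    (hBV : ∀ m : ℤ, M0 (e0 (Finsupp.single m 1)) = Finsupp.single m m)
    :
    ∀ i : ℤ, 1 ≤ i → Nonempty (H (2 * i) ≃+ ℤ) := by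
  have hinj : ∀ i j : ℤ, 2 ≤ i → j = i - 2 → Function.Injective (c i j) := by
    rintro i _ hi rfl
    exact hcinj i hi
  have he0_surj : Function.Surjective e0 := by
    intro y
    have hy : y ∈ e0.range := by
      rw [he0c]
      exact hneg (-2) (by norm_num) _
    exact hy
  have hrange : (c 2 0).range = (e0.comp (Finsupp.singleAddHom 0)).range := by
    have hker := ker_eq_range_singleAddHom_zero (M0.comp e0) hBV
    rw [hc20, AddMonoidHom.range_comp, ← hker, ← AddMonoidHom.comap_ker,
      AddSubgroup.map_comap_eq_self_of_surjective he0_surj]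
  have hbase : Nonempty (H 2 ≃+ ℤ) :=
    nonempty_addEquiv_of_range_eq (hinj 2 0 le_rfl (by norm_num))
      (he0_inj.comp (Finsupp.single_injective 0)) hrange
  intro i hi
  induction i, hi using Int.leInduction with
  | base => exact hbase
  | succ k hk ih =>
    obtain ⟨φ⟩ := ih
    rw [show 2 * (k + 1) = 2 * k + 2 by ring]
    exact ⟨(AddEquiv.ofBijective (c (2 * k + 2) (2 * k))
      ⟨hinj _ _ (by lia) (by ring), hcsurj _ (by lia)⟩).trans φ⟩
end

section
/- In H_1, the element e_1(1⊗x^n) has order exactly |n| for every n ∈ ℤ with n ≠ 0, and the element e_1(1⊗x^0) = e_1(1⊗1) has infinite order. -/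
/-- An additive endomorphism of `⨁ ℤ` scaling the `m`-th basis vector by `m`
scales the `m`-th coordinate by `m`. -/
theorem addMonoidHom_apply_eq_mul_of_single (D : (ℤ →₀ ℤ) →+ (ℤ →₀ ℤ))
    (hD : ∀ m : ℤ, D (Finsupp.single m 1) = Finsupp.single m m) (f : ℤ →₀ ℤ) (m : ℤ) :
    D f m = m * f m := by
  induction f using Finsupp.induction_linear with
  | zero => simp
  | add f g hf hg => simp [hf, hg, mul_add]
  | single a b =>
    have hab : Finsupp.single a b = b • Finsupp.single a (1 : ℤ) := by simp
    rw [hab, map_zsmul, hD]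
    by_cases h : a = m
    · subst h; simp [mul_comm]
    · simp [h]


/-- In `H₁`, the element `e₁(1⊗xⁿ)` has order exactly `|n|` for `n ≠ 0`,
and `e₁(1⊗x⁰) = e₁(1⊗1)` has infinite order. -/
theorem stmt3
    (H : ℤ → Type) [∀ i, AddCommGroup (H i)]
    -- H_i = 0 in negative degrees
    (hneg : ∀ i : ℤ, i < 0 → ∀ x : H i, x = 0)
    -- erasing maps: e₀ : ℍ₋₁ = ⊕_{n∈ℤ} ℤ·(a⊗xⁿ) → H₀ and e₁ : ℍ₀ = ⊕_{n∈ℤ} ℤ·(1⊗xⁿ) → H₁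
    (e0 : (ℤ →₀ ℤ) →+ H 0)
    (e1 : (ℤ →₀ ℤ) →+ H 1)
    -- cap product with the Euler class; c i j is only meaningful when j = i - 2
    (c : ∀ i j : ℤ, H i →+ H j)
    -- marking map M₀ : H₀ → ℍ₀ (the only degree where ℍ is nonzero in the image of M)
    (M0 : H 0 →+ (ℤ →₀ ℤ))
    -- exactness of ⋯ → ℍ_{i-1} → H_i → H_{i-2} → ℍ_{i-2} → H_{i-1} → ⋯ :
    (he0_inj : Function.Injective e0)
    (he0c : AddMonoidHom.range e0 = AddMonoidHom.ker (c 0 (-2)))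
    (hc20 : AddMonoidHom.range (c 2 0) = AddMonoidHom.ker M0)
    (hkere1 : AddMonoidHom.ker e1 = AddMonoidHom.range M0)
    (he1c : AddMonoidHom.range e1 = AddMonoidHom.ker (c 1 (-1)))
    (hcinj : ∀ i : ℤ, 2 ≤ i → Function.Injective (c i (i - 2)))
    (hcsurj : ∀ i : ℤ, 1 ≤ i → Function.Surjective (c (i + 2) i))
    -- BV operator: M ∘ e = Δ, Δ(a⊗xⁿ) = n·(1⊗xⁿ)
    (hBV : ∀ m : ℤ, M0 (e0 (Finsupp.single m 1)) = Finsupp.single m m)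
    :
    (∀ m : ℤ, m ≠ 0 → addOrderOf (e1 (Finsupp.single m 1)) = m.natAbs) ∧
      ¬ IsOfFinAddOrder (e1 (Finsupp.single (0 : ℤ) 1)) := by
  have he0_surj : Function.Surjective e0 := fun y => by
    have hy : y ∈ AddMonoidHom.ker (c 0 (-2)) := hneg (-2) (by norm_num) _
    rwa [← he0c] at hy
  have hD := addMonoidHom_apply_eq_mul_of_single (M0.comp e0) hBV
  have key (m : ℤ) (k : ℕ) : k • e1 (Finsupp.single m 1) = 0 ↔ m ∣ (k : ℤ) := by
    rw [← map_nsmul, ← AddMonoidHom.mem_ker, hkere1]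
    constructor
    · rintro ⟨y, hy⟩
      obtain ⟨f, rfl⟩ := he0_surj y
      refine ⟨f m, ?_⟩
      rw [← hD, AddMonoidHom.comp_apply, hy]
      simp
    · rintro ⟨q, hq⟩
      refine ⟨e0 (q • Finsupp.single m 1), ?_⟩
      rw [map_zsmul, map_zsmul, hBV, Finsupp.smul_single, Finsupp.smul_single]
      simp [hq, mul_comm]
  refine ⟨fun m _ => Nat.dvd_right_iff_eq.mp fun k => ?_, ?_⟩
  · rw [addOrderOf_dvd_iff_nsmul_eq_zero, key, Int.natAbs_dvd_natAbs.symm, Int.natAbs_natCast]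
  · rw [isOfFinAddOrder_iff_nsmul_eq_zero]
    rintro ⟨k, hk, h⟩
    rw [key, zero_dvd_iff] at h
    omega
end

section
/- For all n, m ∈ ℤ one has the string bracket formula [e_0(a⊗x^n), e_0(a⊗x^m)] = −nm·e_1(1⊗x^{n+m}) in H_1; moreover this bracket is zero if and only if either (n+m ≠ 0 and (n+m) divides nm) or (n+m = 0 and n = 0). In particular the string bracket of S^1 is nontrivial only on torsion-producing classes (Theorem 3.2(1)). -/
/-- If `M ∘ e` is the BV operator `xⁿ ↦ n xⁿ` and `e` is surjective, then `a xᵏ` lies in the range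
of `M` exactly when `k` divides `a`. -/
theorem single_mem_range_iff_dvd {G : Type*} [AddCommGroup G]
    (e : AddMonoidAlgebra ℤ ℤ →+ G) (M : G →+ AddMonoidAlgebra ℤ ℤ)
    (he : Function.Surjective e)
    (hBV : ∀ m : ℤ, M (e (AddMonoidAlgebra.single m 1)) = AddMonoidAlgebra.single m m) (k a : ℤ) :
    AddMonoidAlgebra.single k a ∈ M.range ↔ k ∣ a := by
  have hsingle (m b : ℤ) :
      M (e (AddMonoidAlgebra.single m b)) = AddMonoidAlgebra.single m (b * m) := by
    have h : (AddMonoidAlgebra.single m b : AddMonoidAlgebra ℤ ℤ)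
        = b • AddMonoidAlgebra.single m 1 := by
      rw [AddMonoidAlgebra.smul_single, smul_eq_mul, mul_one]
    rw [h, map_zsmul, map_zsmul, hBV, AddMonoidAlgebra.smul_single, smul_eq_mul]
  constructor
  · rintro ⟨y, hy⟩
    obtain ⟨f, rfl⟩ := he y
    have hdvd (g : AddMonoidAlgebra ℤ ℤ) : k ∣ (M (e g)).coeff k := by
      induction g using AddMonoidAlgebra.induction_linear with
      | zero => simp
      | add g₁ g₂ h₁ h₂ => simpa using dvd_add h₁ h₂
      | single m b =>
        rw [hsingle, AddMonoidAlgebra.coeff_single, Finsupp.single_apply]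
        split_ifs with h
        · exact h ▸ dvd_mul_left m b
        · exact dvd_zero k
    have h := hdvd f
    rwa [hy, AddMonoidAlgebra.coeff_single, Finsupp.single_eq_same] at h
  · rintro ⟨b, rfl⟩
    exact ⟨e (AddMonoidAlgebra.single k b), by rw [hsingle, mul_comm]⟩

/-- String bracket of `S¹` (Theorem 3.2(1)): with the loop product on `ℍ₀ = ℤ[x,x⁻¹]`
(the group algebra `AddMonoidAlgebra ℤ ℤ`, so `(1⊗xⁿ)•(1⊗xᵐ) = 1⊗x^{n+m}`), for all `n, m ∈ ℤ`:
`[e₀(a⊗xⁿ), e₀(a⊗xᵐ)] = (-1)^{0-1}·e₁(M₀(e₀(a⊗xⁿ))•M₀(e₀(a⊗xᵐ))) = -nm·e₁(1⊗x^{n+m})`,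
and this bracket vanishes iff `(n+m ≠ 0 ∧ (n+m) ∣ nm)` or `(n+m = 0 ∧ n = 0)`. -/
theorem stmt4
    (H : ℤ → Type) [∀ i, AddCommGroup (H i)]
    -- H_i = 0 in negative degrees
    (hneg : ∀ i : ℤ, i < 0 → ∀ x : H i, x = 0)
    -- erasing maps: e₀ : ℍ₋₁ = ⊕_{n∈ℤ} ℤ·(a⊗xⁿ) → H₀ and e₁ : ℍ₀ = ⊕_{n∈ℤ} ℤ·(1⊗xⁿ) → H₁
    (e0 : AddMonoidAlgebra ℤ ℤ →+ H 0)
    (e1 : AddMonoidAlgebra ℤ ℤ →+ H 1)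
    -- cap product with the Euler class; c i j is only meaningful when j = i - 2
    (c : ∀ i j : ℤ, H i →+ H j)
    -- marking map M₀ : H₀ → ℍ₀ (the only degree where ℍ is nonzero in the image of M)
    (M0 : H 0 →+ AddMonoidAlgebra ℤ ℤ)
    -- exactness of ⋯ → ℍ_{i-1} → H_i → H_{i-2} → ℍ_{i-2} → H_{i-1} → ⋯ :
    (he0_inj : Function.Injective e0)
    (he0c : AddMonoidHom.range e0 = AddMonoidHom.ker (c 0 (-2)))
    (hc20 : AddMonoidHom.range (c 2 0) = AddMonoidHom.ker M0)
    (hkere1 : AddMonoidHom.ker e1 = AddMonoidHom.range M0)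
    (he1c : AddMonoidHom.range e1 = AddMonoidHom.ker (c 1 (-1)))
    (hcinj : ∀ i : ℤ, 2 ≤ i → Function.Injective (c i (i - 2)))
    (hcsurj : ∀ i : ℤ, 1 ≤ i → Function.Surjective (c (i + 2) i))
    -- BV operator: M ∘ e = Δ, Δ(a⊗xⁿ) = n·(1⊗xⁿ)
    (hBV : ∀ m : ℤ, M0 (e0 (AddMonoidAlgebra.single m 1)) = AddMonoidAlgebra.single m m)
    :
    ∀ p q : ℤ,
      ((((-1 : ℤˣ) ^ ((0 : ℤ) - 1) : ℤˣ) : ℤ) •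
          e1 (M0 (e0 (AddMonoidAlgebra.single p 1)) * M0 (e0 (AddMonoidAlgebra.single q 1)))
        = (-(p * q)) • e1 (AddMonoidAlgebra.single (p + q) 1)) ∧
      ((-(p * q)) • e1 (AddMonoidAlgebra.single (p + q) 1) = 0 ↔
        ((p + q ≠ 0 ∧ (p + q) ∣ p * q) ∨ (p + q = 0 ∧ p = 0))) := by
  have he0_surj : Function.Surjective e0 := by
    intro y
    have hy : y ∈ AddMonoidHom.ker (c 0 (-2)) := hneg (-2) (by norm_num) _
    rwa [← he0c] at hy
  have hker (k a : ℤ) : e1 (AddMonoidAlgebra.single k a) = 0 ↔ k ∣ a := by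
    rw [← AddMonoidHom.mem_ker, hkere1]
    exact single_mem_range_iff_dvd e0 M0 he0_surj hBV k a
  intro p q
  have hsmul : (-(p * q)) • e1 (AddMonoidAlgebra.single (p + q) 1)
      = e1 (AddMonoidAlgebra.single (p + q) (-(p * q))) := by
    rw [← map_zsmul, AddMonoidAlgebra.smul_single, smul_eq_mul, mul_one]
  refine ⟨?_, ?_⟩
  · rw [hsmul, hBV, hBV, AddMonoidAlgebra.single_mul_single, ← map_zsmul,
      AddMonoidAlgebra.smul_single]
    simp
  · rw [hsmul, hker, dvd_neg]
    by_cases h : p + q = 0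
    · obtain rfl : q = -p := by omega
      simp
    · simp [h]
end

section
/- H_0 ≅ ℤ, and for every i ≥ 1: if (n−1) does not divide 2i then H_{2i} ≅ ℤ, while if 2i = m(n−1) for some integer m ≥ 1 then H_{2i} ≅ ℤ ⊕ ℤ and the class e(a⊗u^m) ∈ H_{m(n−1)} has infinite order (this is the even-degree part of Theorem 3.1(2) for odd spheres). -/
/-- Even-degree string homology of an odd sphere `Sⁿ` (Theorem 3.1(2)): `H₀ ≅ ℤ`;
for `i ≥ 1`, if `(n-1) ∤ 2i` then `H_{2i} ≅ ℤ`, while if `2i = m(n-1)` with `m ≥ 1` then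
`H_{2i} ≅ ℤ ⊕ ℤ` and `e(a⊗uᵐ) ∈ H_{m(n-1)}` has infinite order. -/
theorem stmt5
    (n : ℤ) (hodd : Odd n) (hn3 : 3 ≤ n)
    (H : ℤ → Type) [∀ i, AddCommGroup (H i)]
    -- H_i = 0 in negative degrees
    (hneg : ∀ i : ℤ, i < 0 → ∀ x : H i, x = 0)
    -- erasing maps on the pieces of ℍ = Λ[a]⊗ℤ[u]:  `eA m` is e on ℤ·(a⊗uᵐ) (meaningful
    -- at degree m(n-1)), `eU m` is e on ℤ·(1⊗uᵐ) (meaningful at degree m(n-1)+n)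
    (eA : ℕ → ∀ i : ℤ, ℤ →+ H i)
    (eU : ℕ → ∀ i : ℤ, ℤ →+ H i)
    -- marking maps into the pieces of ℍ:  `MA m` into ℤ·(a⊗uᵐ) (meaningful at degree
    -- m(n-1)-1), `MU m` into ℤ·(1⊗uᵐ) (meaningful at degree m(n-1)+n-1)
    (MA : ℕ → ∀ i : ℤ, H i →+ ℤ)
    (MU : ℕ → ∀ i : ℤ, H i →+ ℤ)
    -- cap product with the Euler class; c i j is only meaningful when j = i - 2
    (c : ∀ i j : ℤ, H i →+ H j)
    -- classes coming from H_*(ℂP^∞): ι m is meaningful at degree 2m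
    (ι : ℕ → ∀ i : ℤ, ℤ →+ H i)
    -- exactness of ⋯ → ℍ_{i-n} →e→ H_i →c→ H_{i-2} →M→ ℍ_{i-n-1} →e→ H_{i-1} → ⋯ :
    (hexA : ∀ m : ℕ, AddMonoidHom.range (eA m ((m : ℤ) * (n - 1))) =
      AddMonoidHom.ker (c ((m : ℤ) * (n - 1)) ((m : ℤ) * (n - 1) - 2)))
    (hexU : ∀ m : ℕ, AddMonoidHom.range (eU m ((m : ℤ) * (n - 1) + n)) =
      AddMonoidHom.ker (c ((m : ℤ) * (n - 1) + n) ((m : ℤ) * (n - 1) + n - 2)))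
    (hcinj : ∀ i : ℤ, (∀ m : ℕ, i ≠ (m : ℤ) * (n - 1)) → (∀ m : ℕ, i ≠ (m : ℤ) * (n - 1) + n) →
      Function.Injective (c i (i - 2)))
    (hexMU : ∀ m : ℕ, AddMonoidHom.range (c ((m : ℤ) * (n - 1) + n + 1) ((m : ℤ) * (n - 1) + n - 1)) =
      AddMonoidHom.ker (MU m ((m : ℤ) * (n - 1) + n - 1)))
    (hexMA : ∀ m : ℕ, AddMonoidHom.range (c ((m : ℤ) * (n - 1) + 1) ((m : ℤ) * (n - 1) - 1)) =
      AddMonoidHom.ker (MA m ((m : ℤ) * (n - 1) - 1)))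
    (hcsurj : ∀ i : ℤ, (∀ m : ℕ, i ≠ (m : ℤ) * (n - 1) + n - 1) → (∀ m : ℕ, i ≠ (m : ℤ) * (n - 1) - 1) →
      Function.Surjective (c (i + 2) i))
    (hkerA : ∀ m : ℕ, AddMonoidHom.ker (eA m ((m : ℤ) * (n - 1))) =
      AddMonoidHom.range (MA m ((m : ℤ) * (n - 1) - 1)))
    (hkerU : ∀ m : ℕ, AddMonoidHom.ker (eU m ((m : ℤ) * (n - 1) + n)) =
      AddMonoidHom.range (MU m ((m : ℤ) * (n - 1) + n - 1)))
    -- BV operator: M ∘ e = Δ with Δ(a⊗uᵐ) = m·(1⊗u^{m-1}) and Δ(1⊗uᵐ) = 0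
    (hBVA : ∀ m : ℕ, 1 ≤ m → ∀ z : ℤ,
      MU (m - 1) ((m : ℤ) * (n - 1)) (eA m ((m : ℤ) * (n - 1)) z) = (m : ℤ) * z)
    (hBVU : ∀ m m' : ℕ, (m' : ℤ) * (n - 1) - 1 = (m : ℤ) * (n - 1) + n → ∀ z : ℤ,
      MA m' ((m : ℤ) * (n - 1) + n) (eU m ((m : ℤ) * (n - 1) + n) z) = 0)
    -- ι₀ is an isomorphism, c ∘ ι = ι (one degree down), M ∘ ι = 0
    (hι0 : Function.Bijective (ι 0 0))
    (hιc : ∀ m : ℕ, 1 ≤ m → ∀ z : ℤ,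
      c (2 * (m : ℤ)) (2 * (m : ℤ) - 2) (ι m (2 * (m : ℤ)) z) = ι (m - 1) (2 * (m : ℤ) - 2) z)
    (hιM : ∀ m m' : ℕ, 2 * (m : ℤ) = (m' : ℤ) * (n - 1) + n - 1 → ∀ z : ℤ,
      MU m' (2 * (m : ℤ)) (ι m (2 * (m : ℤ)) z) = 0)
    :
    Nonempty (H 0 ≃+ ℤ) ∧
      (∀ i : ℤ, 1 ≤ i → ¬ ((n - 1) ∣ 2 * i) → Nonempty (H (2 * i) ≃+ ℤ)) ∧
      (∀ i : ℤ, 1 ≤ i → ∀ m : ℕ, 1 ≤ m → 2 * i = (m : ℤ) * (n - 1) →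
        Nonempty (H (2 * i) ≃+ ℤ × ℤ) ∧ ¬ IsOfFinAddOrder (eA m (2 * i) 1)) := by
  obtain ⟨k, hk⟩ := hodd
  have exA : ∀ (m : ℕ) (i : ℤ), i = (m : ℤ) * (n - 1) → ∀ x : H i, c i (i - 2) x = 0 →
      ∃ w, eA m i w = x := by
    rintro m _ rfl x hx
    have hmem : x ∈ (eA m ((m : ℤ) * (n - 1))).range := by rw [hexA m]; exact hx
    exact hmem
  have exMU : ∀ (m : ℕ) (i j : ℤ), i = (m : ℤ) * (n - 1) + n + 1 →
      j = (m : ℤ) * (n - 1) + n - 1 → ∀ x : H i, MU m j (c i j x) = 0 := by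
    rintro m _ _ rfl rfl x
    have hmem : c ((m : ℤ) * (n - 1) + n + 1) ((m : ℤ) * (n - 1) + n - 1) x ∈
        (MU m ((m : ℤ) * (n - 1) + n - 1)).ker := by
      rw [← hexMU m]
      exact ⟨x, rfl⟩
    exact hmem
  have BVA : ∀ (m : ℕ) (i : ℤ), i = ((m + 1 : ℕ) : ℤ) * (n - 1) → ∀ z : ℤ,
      MU m i (eA (m + 1) i z) = ((m + 1 : ℕ) : ℤ) * z := by
    rintro m _ rfl z
    exact hBVA (m + 1) (by omega) z
  have ιc : ∀ (m : ℕ) (i : ℤ), i = 2 * ((m + 1 : ℕ) : ℤ) → ∀ z : ℤ,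
      c i (i - 2) (ι (m + 1) i z) = ι m (i - 2) z := by
    rintro m _ rfl z
    exact hιc (m + 1) (by omega) z
  have ιM : ∀ (m m' : ℕ) (i : ℤ), i = 2 * (m : ℤ) → i = ((m' + 1 : ℕ) : ℤ) * (n - 1) → ∀ z : ℤ,
      MU m' i (ι m i z) = 0 := by
    rintro m m' _ rfl h z
    exact hιM m m' (by rw [h]; push_cast; ring) z
  -- an even degree is never of the form `m(n-1)+n`
  have not_odd : ∀ (i : ℤ) (m : ℕ), 2 * i ≠ (m : ℤ) * (n - 1) + n := by
    intro i m h
    have : 2 * i = 2 * (m * k + k) + 1 := by rw [h, hk]; ring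
    omega
  have key : ∀ (m : ℕ) (i : ℤ), i = 2 * (m : ℤ) → Function.Injective (ι m i) ∧
      ∀ x : H i, (∀ m' : ℕ, i = ((m' + 1 : ℕ) : ℤ) * (n - 1) → MU m' i x = 0) →
        ∃ z, ι m i z = x := by
    intro m
    induction m with
    | zero =>
      rintro i hi
      obtain rfl : i = 0 := by simpa using hi
      exact ⟨hι0.1, fun x _ => hι0.2 x⟩
    | succ m ih =>
      intro i hi
      obtain ⟨inj, surj⟩ := ih (i - 2) (by rw [hi]; push_cast; ring)
      refine ⟨fun z w h => inj (by rw [← ιc m i hi, ← ιc m i hi, h]), fun x hx => ?_⟩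
      obtain ⟨z, hz⟩ := surj (c i (i - 2) x) (fun m' hm' => exMU m' i (i - 2)
        (by push_cast at hm'; linarith) (by push_cast at hm'; linarith) x)
      rw [← ιc m i hi] at hz
      refine ⟨z, ?_⟩
      by_cases hdiv : ∃ m' : ℕ, i = (m' : ℤ) * (n - 1)
      · obtain ⟨m', hm'⟩ := hdiv
        obtain _ | m' := m'
        · push_cast at hi hm'; omega
        obtain ⟨w, hw⟩ := exA (m' + 1) i hm' (x - ι (m + 1) i z) (by rw [map_sub, hz, sub_self])
        have h1 := BVA m' i hm' w
        rw [hw, map_sub, hx m' hm', ιM (m + 1) m' i hi hm', sub_self] at h1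
        have hw0 : w = 0 := by
          rcases mul_eq_zero.1 h1.symm with h | h
          · omega
          · exact h
        rw [hw0, map_zero] at hw
        exact (sub_eq_zero.1 hw.symm).symm
      · push Not at hdiv
        exact hcinj i hdiv (fun m' => hi ▸ not_odd _ m') hz
  refine ⟨⟨(AddEquiv.ofBijective (ι 0 0) hι0).symm⟩, fun i hi hdiv => ?_, fun i hi m hm him => ?_⟩
  · lift i to ℕ using by omega
    obtain ⟨inj, surj⟩ := key i _ rfl
    exact ⟨(AddEquiv.ofBijective (ι i (2 * (i : ℤ))) ⟨inj, fun x => surj x fun m' hm' =>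
      absurd ⟨((m' + 1 : ℕ) : ℤ), by rw [hm', mul_comm]⟩ hdiv⟩).symm⟩
  · lift i to ℕ using by omega
    obtain ⟨i, rfl⟩ : ∃ j, i = j + 1 := ⟨i - 1, by omega⟩
    obtain ⟨m, rfl⟩ : ∃ j, m = j + 1 := ⟨m - 1, by omega⟩
    generalize hd : 2 * ((i + 1 : ℕ) : ℤ) = d at him ⊢
    have inj := (key (i + 1) d hd.symm).1
    have eA_zero : ∀ w, MU m d (eA (m + 1) d w) = 0 → w = 0 := by
      intro w hw
      rw [BVA m d him] at hw
      rcases mul_eq_zero.1 hw with h | h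
      · omega
      · exact h
    refine ⟨⟨(AddEquiv.ofBijective ((ι (i + 1) d).coprod (eA (m + 1) d)) ⟨?_, ?_⟩).symm⟩, ?_⟩
    · rw [injective_iff_map_eq_zero]
      rintro ⟨z, w⟩ h
      rw [AddMonoidHom.coprod_apply] at h
      obtain rfl : w = 0 := eA_zero w (by
        have h' := congrArg (MU m d) h
        rwa [map_add, ιM (i + 1) m d hd.symm him, zero_add, map_zero] at h')
      rw [map_zero, add_zero] at h
      rw [(injective_iff_map_eq_zero _).1 inj z h]
      rfl
    · intro x
      obtain ⟨-, surj⟩ := key i (d - 2) (by rw [← hd]; push_cast; ring)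
      obtain ⟨z, hz⟩ := surj (c d (d - 2) x) (fun m' hm' => exMU m' d (d - 2)
        (by push_cast at hm'; linarith) (by push_cast at hm'; linarith) x)
      rw [← ιc i d hd.symm] at hz
      obtain ⟨w, hw⟩ := exA (m + 1) d him (x - ι (i + 1) d z) (by rw [map_sub, hz, sub_self])
      exact ⟨(z, w), by rw [AddMonoidHom.coprod_apply, hw, add_sub_cancel]⟩
    · rw [isOfFinAddOrder_iff_nsmul_eq_zero]
      rintro ⟨N, hN, h⟩
      rw [← map_nsmul] at h
      have := eA_zero _ (by rw [h, map_zero])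
      simp at this
      omega
end

section
/- For every i ≥ 0, the group H_{2i+1} is a finite group of order k!, where k = ⌊2i/(n−1)⌋; in particular H_{2i+1} = 0 whenever 2i < 2(n−1) (this is the odd-degree torsion part of Theorem 3.1(2) for odd spheres). -/
theorem AddMonoidHom.natCard_eq_card_ker_mul_card_of_surjective {G K : Type*} [AddCommGroup G]
    [AddCommGroup K] (f : G →+ K) (hf : Function.Surjective f) :
    Nat.card G = Nat.card f.ker * Nat.card K := by
  rw [← AddSubgroup.card_mul_index f.ker, AddSubgroup.index_ker,
    AddMonoidHom.range_eq_top.mpr hf, AddSubgroup.card_top]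

theorem AddMonoidHom.eq_zero_of_finite_of_int {G : Type*} [AddCommGroup G] [Finite G]
    (f : G →+ ℤ) : f = 0 := by
  ext x
  have h : Nat.card G • f x = 0 := by rw [← map_nsmul, card_nsmul_eq_zero', map_zero]
  simpa [Nat.card_pos.ne'] using h


/-- Odd-degree string homology of an odd sphere `Sⁿ` (Theorem 3.1(2)): for every `i ≥ 0`,
`H_{2i+1}` is a finite group of order `k!` where `k = ⌊2i/(n-1)⌋`; in particular
`H_{2i+1} = 0` whenever `2i < 2(n-1)`. -/
theorem stmt6
    (n : ℤ) (hodd : Odd n) (hn3 : 3 ≤ n)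
    (H : ℤ → Type) [∀ i, AddCommGroup (H i)]
    -- H_i = 0 in negative degrees
    (hneg : ∀ i : ℤ, i < 0 → ∀ x : H i, x = 0)
    -- erasing maps on the pieces of ℍ = Λ[a]⊗ℤ[u]:  `eA m` is e on ℤ·(a⊗uᵐ) (meaningful
    -- at degree m(n-1)), `eU m` is e on ℤ·(1⊗uᵐ) (meaningful at degree m(n-1)+n)
    (eA : ℕ → ∀ i : ℤ, ℤ →+ H i)
    (eU : ℕ → ∀ i : ℤ, ℤ →+ H i)
    -- marking maps into the pieces of ℍ:  `MA m` into ℤ·(a⊗uᵐ) (meaningful at degree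
    -- m(n-1)-1), `MU m` into ℤ·(1⊗uᵐ) (meaningful at degree m(n-1)+n-1)
    (MA : ℕ → ∀ i : ℤ, H i →+ ℤ)
    (MU : ℕ → ∀ i : ℤ, H i →+ ℤ)
    -- cap product with the Euler class; c i j is only meaningful when j = i - 2
    (c : ∀ i j : ℤ, H i →+ H j)
    -- classes coming from H_*(ℂP^∞): ι m is meaningful at degree 2m
    (ι : ℕ → ∀ i : ℤ, ℤ →+ H i)
    -- exactness of ⋯ → ℍ_{i-n} →e→ H_i →c→ H_{i-2} →M→ ℍ_{i-n-1} →e→ H_{i-1} → ⋯ :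
    (hexA : ∀ m : ℕ, AddMonoidHom.range (eA m ((m : ℤ) * (n - 1))) =
      AddMonoidHom.ker (c ((m : ℤ) * (n - 1)) ((m : ℤ) * (n - 1) - 2)))
    (hexU : ∀ m : ℕ, AddMonoidHom.range (eU m ((m : ℤ) * (n - 1) + n)) =
      AddMonoidHom.ker (c ((m : ℤ) * (n - 1) + n) ((m : ℤ) * (n - 1) + n - 2)))
    (hcinj : ∀ i : ℤ, (∀ m : ℕ, i ≠ (m : ℤ) * (n - 1)) → (∀ m : ℕ, i ≠ (m : ℤ) * (n - 1) + n) →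
      Function.Injective (c i (i - 2)))
    (hexMU : ∀ m : ℕ, AddMonoidHom.range (c ((m : ℤ) * (n - 1) + n + 1) ((m : ℤ) * (n - 1) + n - 1)) =
      AddMonoidHom.ker (MU m ((m : ℤ) * (n - 1) + n - 1)))
    (hexMA : ∀ m : ℕ, AddMonoidHom.range (c ((m : ℤ) * (n - 1) + 1) ((m : ℤ) * (n - 1) - 1)) =
      AddMonoidHom.ker (MA m ((m : ℤ) * (n - 1) - 1)))
    (hcsurj : ∀ i : ℤ, (∀ m : ℕ, i ≠ (m : ℤ) * (n - 1) + n - 1) → (∀ m : ℕ, i ≠ (m : ℤ) * (n - 1) - 1) →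
      Function.Surjective (c (i + 2) i))
    (hkerA : ∀ m : ℕ, AddMonoidHom.ker (eA m ((m : ℤ) * (n - 1))) =
      AddMonoidHom.range (MA m ((m : ℤ) * (n - 1) - 1)))
    (hkerU : ∀ m : ℕ, AddMonoidHom.ker (eU m ((m : ℤ) * (n - 1) + n)) =
      AddMonoidHom.range (MU m ((m : ℤ) * (n - 1) + n - 1)))
    -- BV operator: M ∘ e = Δ with Δ(a⊗uᵐ) = m·(1⊗u^{m-1}) and Δ(1⊗uᵐ) = 0
    (hBVA : ∀ m : ℕ, 1 ≤ m → ∀ z : ℤ,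
      MU (m - 1) ((m : ℤ) * (n - 1)) (eA m ((m : ℤ) * (n - 1)) z) = (m : ℤ) * z)
    (hBVU : ∀ m m' : ℕ, (m' : ℤ) * (n - 1) - 1 = (m : ℤ) * (n - 1) + n → ∀ z : ℤ,
      MA m' ((m : ℤ) * (n - 1) + n) (eU m ((m : ℤ) * (n - 1) + n) z) = 0)
    -- ι₀ is an isomorphism, c ∘ ι = ι (one degree down), M ∘ ι = 0
    (hι0 : Function.Bijective (ι 0 0))
    (hιc : ∀ m : ℕ, 1 ≤ m → ∀ z : ℤ,
      c (2 * (m : ℤ)) (2 * (m : ℤ) - 2) (ι m (2 * (m : ℤ)) z) = ι (m - 1) (2 * (m : ℤ) - 2) z)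
    (hιM : ∀ m m' : ℕ, 2 * (m : ℤ) = (m' : ℤ) * (n - 1) + n - 1 → ∀ z : ℤ,
      MU m' (2 * (m : ℤ)) (ι m (2 * (m : ℤ)) z) = 0)
    :
    ∀ i : ℕ,
      (Finite (H (2 * (i : ℤ) + 1)) ∧
        Nat.card (H (2 * (i : ℤ) + 1)) = Nat.factorial (2 * i / (n - 1).toNat)) ∧
      (2 * (i : ℤ) < 2 * (n - 1) → ∀ x : H (2 * (i : ℤ) + 1), x = 0) := by
  obtain ⟨e, rfl, he⟩ : ∃ e : ℕ, n = 2 * (e : ℤ) + 1 ∧ 1 ≤ e := by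
    obtain ⟨t, ht⟩ := hodd
    exact ⟨t.toNat, by omega, by omega⟩
  rw [add_sub_cancel_right (2 * (e : ℤ)) 1]
    at hexA hexU hcinj hexMU hexMA hcsurj hkerU hBVA hιM ⊢
  -- Versions of the hypotheses with free degrees, so that no transport along equalities is needed.
  have exA : ∀ (m : ℕ) (k l : ℤ), k = m * (2 * e) → l = k - 2 →
      (eA m k).range = (c k l).ker := by
    rintro m k l rfl rfl; exact hexA m
  have exU : ∀ (m : ℕ) (k l : ℤ), k = m * (2 * e) + (2 * e + 1) → l = k - 2 →
      (eU m k).range = (c k l).ker := by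
    rintro m k l rfl rfl; exact hexU m
  have cinj : ∀ k l : ℤ, l = k - 2 → (∀ m : ℕ, k ≠ m * (2 * e)) →
      (∀ m : ℕ, k ≠ m * (2 * e) + (2 * e + 1)) → Function.Injective (c k l) := by
    rintro k l rfl; exact hcinj k
  have exMU : ∀ (m : ℕ) (k l : ℤ), l = (m + 1) * (2 * e) → k = l + 2 →
      (c k l).range = (MU m l).ker := by
    rintro m k l hl hk
    obtain rfl : l = m * (2 * e) + (2 * e + 1) - 1 := by rw [hl]; ring
    obtain rfl : k = m * (2 * e) + (2 * e + 1) + 1 := by rw [hk]; ring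
    exact hexMU m
  have exMA : ∀ (m : ℕ) (k l : ℤ), l = m * (2 * e) - 1 → k = l + 2 →
      (c k l).range = (MA m l).ker := by
    rintro m k l rfl hk
    obtain rfl : k = m * (2 * e) + 1 := by rw [hk]; ring
    exact hexMA m
  have csurj : ∀ k l : ℤ, k = l + 2 → (∀ m : ℕ, l ≠ m * (2 * e) + (2 * e + 1) - 1) →
      (∀ m : ℕ, l ≠ m * (2 * e) - 1) → Function.Surjective (c k l) := by
    rintro k l rfl; exact hcsurj l
  have kerU : ∀ (m : ℕ) (k l : ℤ), l = (m + 1) * (2 * e) → k = l + 1 →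
      (eU m k).ker = (MU m l).range := by
    rintro m k l hl hk
    obtain rfl : l = m * (2 * e) + (2 * e + 1) - 1 := by rw [hl]; ring
    obtain rfl : k = m * (2 * e) + (2 * e + 1) := by rw [hk]; ring
    exact hkerU m
  have BVA : ∀ (m : ℕ) (k : ℤ), k = (m + 1) * (2 * e) → ∀ z : ℤ,
      MU m k (eA (m + 1) k z) = (m + 1) * z := by
    rintro m k hk z
    obtain rfl : k = ((m + 1 : ℕ) : ℤ) * (2 * e) := by rw [hk]; push_cast; ring
    simpa using hBVA (m + 1) (by omega) z
  have ιc : ∀ (m : ℕ) (k l : ℤ), k = 2 * (m + 1) → l = 2 * m → ∀ z : ℤ,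
      c k l (ι (m + 1) k z) = ι m l z := by
    rintro m k l hk hl z
    obtain rfl : k = 2 * ((m + 1 : ℕ) : ℤ) := by rw [hk]; push_cast; ring
    obtain rfl : l = 2 * ((m + 1 : ℕ) : ℤ) - 2 := by rw [hl]; push_cast; ring
    exact hιc (m + 1) (by omega) z
  have ιM : ∀ (m m' : ℕ) (k : ℤ), k = 2 * m → k = (m' + 1) * (2 * e) → ∀ z : ℤ,
      MU m' k (ι m k z) = 0 := by
    rintro m m' k rfl hk z
    exact hιM m m' (by rw [hk]; ring) z
  -- Even degrees are generated by the `ℂP^∞` class and, in degrees `m(n-1)`, by `e(a ⊗ uᵐ)`.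
  have even_gen : ∀ (j : ℕ) (k : ℤ), k = 2 * j → ∀ x : H k, ∃ z : ℤ, x = ι j k z ∨
      ∃ m : ℕ, k = (m + 1) * (2 * e) ∧ ∃ w : ℤ, x = ι j k z + eA (m + 1) k w := by
    intro j
    induction j with
    | zero =>
      intro k hk x
      obtain rfl : k = 0 := by simpa using hk
      obtain ⟨z, rfl⟩ := hι0.2 x
      exact ⟨z, Or.inl rfl⟩
    | succ j ih =>
      intro k hk x
      push_cast at hk
      obtain ⟨z, hz⟩ : ∃ z, c k (2 * j) x = ι j (2 * j) z := by
        obtain ⟨z, hz | ⟨m, hm, w, hw⟩⟩ := ih (2 * j) rfl (c k (2 * j) x)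
        · exact ⟨z, hz⟩
        · have h0 : MU m (2 * j) (c k (2 * j) x) = 0 := by
            rw [← AddMonoidHom.mem_ker, ← exMU m k _ hm (by omega)]
            exact ⟨x, rfl⟩
          rw [hw, map_add, ιM j m _ rfl hm, BVA m _ hm, zero_add] at h0
          have hw0 : w = 0 := (mul_eq_zero.mp h0).resolve_left (by omega)
          exact ⟨z, by rw [hw, hw0, map_zero, add_zero]⟩
      have hker : x - ι (j + 1) k z ∈ (c k (2 * j)).ker := by
        rw [AddMonoidHom.mem_ker, map_sub, hz, ιc j k _ hk rfl, sub_self]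
      refine ⟨z, ?_⟩
      by_cases h : ∃ m : ℕ, k = m * (2 * e)
      · obtain ⟨m, hm⟩ := h
        rw [← exA m k _ hm (by omega)] at hker
        obtain ⟨w, hw⟩ := hker
        obtain _ | m := m
        · simp at hm; omega
        · refine Or.inr ⟨m, by exact_mod_cast hm, w, ?_⟩
          rw [hw]; abel
      · push Not at h
        left
        have := cinj k (2 * j) (by omega) h fun m hm => by
          have : k = 2 * (m * e + e) + 1 := by rw [hm]; ring
          omega
        exact sub_eq_zero.mp (this (by rw [map_zero]; exact hker))
  have range_MU : ∀ (m : ℕ) (l : ℤ), l = (m + 1) * (2 * e) →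
      (MU m l).range = AddSubgroup.zmultiples ((m : ℤ) + 1) := by
    intro m l hl
    have hl2 : l = 2 * ((m + 1) * e : ℕ) := by rw [hl]; push_cast; ring
    ext y
    rw [Int.mem_zmultiples_iff]
    constructor
    · rintro ⟨x, rfl⟩
      obtain ⟨z, rfl | ⟨m', hm', w, rfl⟩⟩ := even_gen _ l hl2 x
      · rw [ιM _ m l hl2 hl]; exact dvd_zero _
      · obtain rfl : m' = m := by
          have h := mul_right_cancel₀ (by omega) (hm'.symm.trans hl)
          omega
        rw [map_add, ιM _ m' l hl2 hl, BVA m' l hl, zero_add]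
        exact dvd_mul_right _ _
    · rintro ⟨w, rfl⟩
      exact ⟨eA (m + 1) l w, BVA m l hl w⟩
  have card_ker : ∀ (m : ℕ) (k l : ℤ), k = (m + 1) * (2 * e) + 1 → l = k - 2 →
      Nat.card (c k l).ker = m + 1 := by
    intro m k l hk hl
    rw [← exU m k l (by rw [hk]; ring) hl, ← AddSubgroup.index_ker,
      kerU m k ((m + 1) * (2 * e)) rfl hk, range_MU m _ rfl, Int.index_zmultiples]
    omega
  have surj : ∀ k l : ℤ, Odd l → k = l + 2 → Finite (H l) → Function.Surjective (c k l) := by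
    intro k l ⟨t, ht⟩ hk hfin
    by_cases h : ∃ m : ℕ, l = m * (2 * e) - 1
    · obtain ⟨m, hm⟩ := h
      rw [← AddMonoidHom.range_eq_top, exMA m k l hm hk,
        AddMonoidHom.eq_zero_of_finite_of_int (MA m l), AddMonoidHom.ker_zero]
    · push Not at h
      refine csurj k l hk (fun m hm => ?_) h
      have : l = 2 * (m * e + e) := by rw [hm]; ring
      omega
  have main : ∀ (j : ℕ) (k : ℤ), k = 2 * j + 1 → Nat.card (H k) = (j / e).factorial := by
    intro j
    induction j with
    | zero =>
      rintro k hk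
      have hinj : Function.Injective (c k (k - 2)) := by
        refine cinj k _ rfl (fun m hm => ?_) fun m hm => ?_
        · have : k = 2 * (m * e) := by rw [hm]; ring
          omega
        · have : (0 : ℤ) ≤ m * (2 * e) := by positivity
          omega
      have : Subsingleton (H (k - 2)) :=
        ⟨fun x y => by rw [hneg _ (by omega) x, hneg _ (by omega) y]⟩
      have := hinj.subsingleton
      simp
    | succ j ih =>
      intro k hk
      push_cast at hk
      have hcard := ih (2 * j + 1) rfl
      have hfin : Finite (H (2 * j + 1)) :=
        Nat.finite_of_card_ne_zero (by rw [hcard]; exact Nat.factorial_ne_zero _)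
      rw [AddMonoidHom.natCard_eq_card_ker_mul_card_of_surjective (c k (2 * j + 1))
        (surj _ _ ⟨j, rfl⟩ (by omega) hfin), hcard, Nat.succ_div]
      split_ifs with hdvd
      · have hq : (j / e + 1) * e = j + 1 := by
          rw [← Nat.div_mul_cancel hdvd, Nat.succ_div_of_dvd hdvd]
        have hq' : ((j / e : ℕ) + 1 : ℤ) * e = j + 1 := by exact_mod_cast hq
        rw [card_ker (j / e) k _ (by rw [mul_left_comm, hq']; exact hk) (by omega),
          Nat.factorial_succ]
      · have hinj : Function.Injective (c k (2 * j + 1)) := by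
          refine cinj k _ (by omega) (fun m hm => ?_) fun m hm => hdvd ⟨m + 1, ?_⟩
          · have : k = 2 * (m * e) := by rw [hm]; ring
            omega
          · have : k = 2 * (e * (m + 1)) + 1 := by rw [hm]; ring
            zify
            omega
        rw [(AddMonoidHom.ker_eq_bot_iff _).mpr hinj, AddSubgroup.card_bot, one_mul, add_zero]
  intro i
  have hcard := main i (2 * i + 1) rfl
  refine ⟨⟨Nat.finite_of_card_ne_zero (by rw [hcard]; exact Nat.factorial_ne_zero _), ?_⟩, ?_⟩
  · rw [hcard, show (2 * (e : ℤ)).toNat = 2 * e by omega, Nat.mul_div_mul_left _ _ two_pos]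
  · intro hi x
    have hlt : i / e < 2 := Nat.div_lt_of_lt_mul (by omega)
    rw [Nat.factorial_eq_one.mpr (by omega)] at hcard
    have := (Nat.card_eq_one_iff_unique.mp hcard).1
    exact Subsingleton.elim _ _
end

section
/- For every m ≥ 0, the element e(1⊗u^m) ∈ H_{m(n−1)+n} has order exactly m+1; in particular e(1⊗1) = 0 and e(1⊗u) generates a subgroup of H_{2n−1} isomorphic to ℤ/2ℤ. -/
/-- If the kernel of a homomorphism out of `ℤ` is `kℤ`, then the image of `1` has order `k`. -/
theorem addOrderOf_map_one_of_map_eq_zero_iff_dvd {G : Type*} [AddCommGroup G] (f : ℤ →+ G) (k : ℕ)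
    (hf : ∀ z : ℤ, f z = 0 ↔ (k : ℤ) ∣ z) : addOrderOf (f 1) = k := by
  have key : ∀ l : ℕ, addOrderOf (f 1) ∣ l ↔ k ∣ l := by
    intro l
    rw [addOrderOf_dvd_iff_nsmul_eq_zero, ← map_nsmul, hf]
    simp [Int.natCast_dvd_natCast]
  exact Nat.dvd_antisymm ((key k).2 dvd_rfl) ((key _).1 dvd_rfl)


/-- For every `m ≥ 0`, the element `e(1⊗uᵐ) ∈ H_{m(n-1)+n}` has order exactly `m+1`;
in particular `e(1⊗1) = 0` and `e(1⊗u)` generates a subgroup of `H_{2n-1}` isomorphic to `ℤ/2ℤ`. -/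
theorem stmt7
    (n : ℤ) (hodd : Odd n) (hn3 : 3 ≤ n)
    (H : ℤ → Type) [∀ i, AddCommGroup (H i)]
    -- H_i = 0 in negative degrees
    (hneg : ∀ i : ℤ, i < 0 → ∀ x : H i, x = 0)
    -- erasing maps on the pieces of ℍ = Λ[a]⊗ℤ[u]:  `eA m` is e on ℤ·(a⊗uᵐ) (meaningful
    -- at degree m(n-1)), `eU m` is e on ℤ·(1⊗uᵐ) (meaningful at degree m(n-1)+n)
    (eA : ℕ → ∀ i : ℤ, ℤ →+ H i)
    (eU : ℕ → ∀ i : ℤ, ℤ →+ H i)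
    -- marking maps into the pieces of ℍ:  `MA m` into ℤ·(a⊗uᵐ) (meaningful at degree
    -- m(n-1)-1), `MU m` into ℤ·(1⊗uᵐ) (meaningful at degree m(n-1)+n-1)
    (MA : ℕ → ∀ i : ℤ, H i →+ ℤ)
    (MU : ℕ → ∀ i : ℤ, H i →+ ℤ)
    -- cap product with the Euler class; c i j is only meaningful when j = i - 2
    (c : ∀ i j : ℤ, H i →+ H j)
    -- classes coming from H_*(ℂP^∞): ι m is meaningful at degree 2m
    (ι : ℕ → ∀ i : ℤ, ℤ →+ H i)
    -- exactness of ⋯ → ℍ_{i-n} →e→ H_i →c→ H_{i-2} →M→ ℍ_{i-n-1} →e→ H_{i-1} → ⋯ :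
    (hexA : ∀ m : ℕ, AddMonoidHom.range (eA m ((m : ℤ) * (n - 1))) =
      AddMonoidHom.ker (c ((m : ℤ) * (n - 1)) ((m : ℤ) * (n - 1) - 2)))
    (hexU : ∀ m : ℕ, AddMonoidHom.range (eU m ((m : ℤ) * (n - 1) + n)) =
      AddMonoidHom.ker (c ((m : ℤ) * (n - 1) + n) ((m : ℤ) * (n - 1) + n - 2)))
    (hcinj : ∀ i : ℤ, (∀ m : ℕ, i ≠ (m : ℤ) * (n - 1)) → (∀ m : ℕ, i ≠ (m : ℤ) * (n - 1) + n) →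
      Function.Injective (c i (i - 2)))
    (hexMU : ∀ m : ℕ, AddMonoidHom.range (c ((m : ℤ) * (n - 1) + n + 1) ((m : ℤ) * (n - 1) + n - 1)) =
      AddMonoidHom.ker (MU m ((m : ℤ) * (n - 1) + n - 1)))
    (hexMA : ∀ m : ℕ, AddMonoidHom.range (c ((m : ℤ) * (n - 1) + 1) ((m : ℤ) * (n - 1) - 1)) =
      AddMonoidHom.ker (MA m ((m : ℤ) * (n - 1) - 1)))
    (hcsurj : ∀ i : ℤ, (∀ m : ℕ, i ≠ (m : ℤ) * (n - 1) + n - 1) → (∀ m : ℕ, i ≠ (m : ℤ) * (n - 1) - 1) →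
      Function.Surjective (c (i + 2) i))
    (hkerA : ∀ m : ℕ, AddMonoidHom.ker (eA m ((m : ℤ) * (n - 1))) =
      AddMonoidHom.range (MA m ((m : ℤ) * (n - 1) - 1)))
    (hkerU : ∀ m : ℕ, AddMonoidHom.ker (eU m ((m : ℤ) * (n - 1) + n)) =
      AddMonoidHom.range (MU m ((m : ℤ) * (n - 1) + n - 1)))
    -- BV operator: M ∘ e = Δ with Δ(a⊗uᵐ) = m·(1⊗u^{m-1}) and Δ(1⊗uᵐ) = 0
    (hBVA : ∀ m : ℕ, 1 ≤ m → ∀ z : ℤ,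
      MU (m - 1) ((m : ℤ) * (n - 1)) (eA m ((m : ℤ) * (n - 1)) z) = (m : ℤ) * z)
    (hBVU : ∀ m m' : ℕ, (m' : ℤ) * (n - 1) - 1 = (m : ℤ) * (n - 1) + n → ∀ z : ℤ,
      MA m' ((m : ℤ) * (n - 1) + n) (eU m ((m : ℤ) * (n - 1) + n) z) = 0)
    -- ι₀ is an isomorphism, c ∘ ι = ι (one degree down), M ∘ ι = 0
    (hι0 : Function.Bijective (ι 0 0))
    (hιc : ∀ m : ℕ, 1 ≤ m → ∀ z : ℤ,
      c (2 * (m : ℤ)) (2 * (m : ℤ) - 2) (ι m (2 * (m : ℤ)) z) = ι (m - 1) (2 * (m : ℤ) - 2) z)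
    (hιM : ∀ m m' : ℕ, 2 * (m : ℤ) = (m' : ℤ) * (n - 1) + n - 1 → ∀ z : ℤ,
      MU m' (2 * (m : ℤ)) (ι m (2 * (m : ℤ)) z) = 0)
    :
    (∀ m : ℕ, addOrderOf (eU m ((m : ℤ) * (n - 1) + n) 1) = m + 1) ∧
      eU 0 (((0 : ℕ) : ℤ) * (n - 1) + n) 1 = 0 ∧
      Nonempty (AddSubgroup.zmultiples (eU 1 (((1 : ℕ) : ℤ) * (n - 1) + n) 1) ≃+ ZMod 2) := by
  obtain ⟨r, hr⟩ := hodd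
  have kerc_even : ∀ i i' : ℤ, i' = i - 2 → ∀ k : ℕ, i = 2 * (k : ℤ) + 2 → ∀ y : H i, c i i' y = 0 →
      (∀ m : ℕ, i = ((m : ℤ) + 1) * (n - 1) → ∃ v, y = eA (m + 1) i v) ∧
      ((∀ m : ℕ, i ≠ ((m : ℤ) + 1) * (n - 1)) → y = 0) := by
    rintro i i' rfl k hk y hy
    refine ⟨fun m hm => ?_, fun hm => ?_⟩
    · subst hm
      have h := hexA (m + 1)
      push_cast at h
      have hy' : y ∈ (c _ _).ker := hy
      rw [← h] at hy'
      obtain ⟨v, hv⟩ := hy'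
      exact ⟨v, hv.symm⟩
    · refine hcinj i (fun m h => ?_) (fun m h => ?_) (by simpa using hy)
      · cases m with
        | zero => simp at h; omega
        | succ m => exact hm m (by push_cast at h; exact h)
      · have : (m : ℤ) * (n - 1) = 2 * (m * r) := by rw [hr]; ring
        omega
  have BV : ∀ (m : ℕ) (i : ℤ), i = ((m : ℤ) + 1) * (n - 1) → ∀ v : ℤ,
      MU m i (eA (m + 1) i v) = ((m : ℤ) + 1) * v := by
    rintro m i rfl v
    simpa using hBVA (m + 1) (by omega) v
  have capι : ∀ (k : ℕ) (i i' : ℤ), i = 2 * (k : ℤ) + 2 → i' = 2 * (k : ℤ) → ∀ z : ℤ,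
      c i i' (ι (k + 1) i z) = ι k i' z := by
    intro k i i' hi hi' z
    have h := hιc (k + 1) (by omega) z
    have e1 : 2 * ((k + 1 : ℕ) : ℤ) = i := by push_cast; omega
    have e2 : i - 2 = i' := by omega
    rw [e1, e2] at h
    exact h
  have Mι : ∀ (k m : ℕ) (i : ℤ), i = 2 * (k : ℤ) → i = ((m : ℤ) + 1) * (n - 1) → ∀ z : ℤ,
      MU m i (ι k i z) = 0 := by
    rintro k m i rfl h z
    exact hιM k m (by rw [h]; ring) z
  have Mc : ∀ (m : ℕ) (i i' : ℤ), i' = ((m : ℤ) + 1) * (n - 1) → i = i' + 2 → ∀ x : H i,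
      MU m i' (c i i' x) = 0 := by
    intro m i i' h hi x
    have h1 := hexMU m
    have e1 : (m : ℤ) * (n - 1) + n - 1 = i' := by rw [h]; ring
    have e2 : (m : ℤ) * (n - 1) + n + 1 = i := by rw [hi, ← e1]; ring
    rw [e1, e2] at h1
    have : c i i' x ∈ (c i i').range := ⟨x, rfl⟩
    rw [h1] at this
    exact this
  have range_cap : ∀ (k : ℕ) (i i' : ℤ), i' = 2 * (k : ℤ) → i = i' + 2 → ∀ x : H i,
      ∃ z, c i i' x = ι k i' z := by
    intro k
    induction k with
    | zero =>
      intro i i' hi' _ x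
      obtain rfl : i' = 0 := by simpa using hi'
      obtain ⟨z, hz⟩ := hι0.2 (c i 0 x)
      exact ⟨z, hz.symm⟩
    | succ k ih =>
      intro i i' hi' hi x
      push_cast at hi'
      obtain ⟨z, hz⟩ := ih i' (i' - 2) (by omega) (by omega) (c i i' x)
      have hker : c i' (i' - 2) (c i i' x - ι (k + 1) i' z) = 0 := by
        rw [map_sub, hz, capι k _ _ (by omega) (by omega), sub_self]
      obtain ⟨hA, hinj⟩ := kerc_even i' (i' - 2) rfl k (by omega) _ hker
      refine ⟨z, sub_eq_zero.1 ?_⟩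
      by_cases hm : ∃ m : ℕ, i' = ((m : ℤ) + 1) * (n - 1)
      · obtain ⟨m, hm⟩ := hm
        obtain ⟨v, hv⟩ := hA m hm
        have h0 := BV m i' hm v
        rw [← hv, map_sub, Mc m i i' hm hi, Mι (k + 1) m i' (by push_cast; omega) hm, sub_self] at h0
        have hv0 : v = 0 := (mul_eq_zero.1 h0.symm).resolve_left (by omega)
        rw [hv, hv0, map_zero]
      · exact hinj (not_exists.1 hm)
  have marking : ∀ (m : ℕ) (i : ℤ), i = ((m : ℤ) + 1) * (n - 1) → ∀ x : H i,
      ((m : ℤ) + 1) ∣ MU m i x := by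
    intro m i hi x
    have hir : i = 2 * ((m + 1) * r) := by rw [hi, hr]; ring
    have hpos : 0 < ((m : ℤ) + 1) * r := mul_pos (by omega) (by omega)
    obtain ⟨k, hk⟩ := Int.eq_ofNat_of_zero_le (show 0 ≤ ((m : ℤ) + 1) * r - 1 by omega)
    obtain ⟨z, hz⟩ := range_cap k i (i - 2) (by omega) (by omega) x
    have hker : c i (i - 2) (x - ι (k + 1) i z) = 0 := by
      rw [map_sub, hz, capι k _ _ (by omega) (by omega), sub_self]
    obtain ⟨v, hv⟩ := (kerc_even i (i - 2) rfl k (by omega) _ hker).1 m hi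
    refine ⟨v, ?_⟩
    rw [← BV m i hi v, ← hv, map_sub, Mι (k + 1) m i (by push_cast; omega) hi, sub_zero]
  have order : ∀ m : ℕ, addOrderOf (eU m ((m : ℤ) * (n - 1) + n) 1) = m + 1 := by
    intro m
    refine addOrderOf_map_one_of_map_eq_zero_iff_dvd _ _ fun z => ?_
    have hi : (m : ℤ) * (n - 1) + n - 1 = ((m : ℤ) + 1) * (n - 1) := by ring
    rw [← AddMonoidHom.mem_ker, hkerU m]
    push_cast
    constructor
    · rintro ⟨x, rfl⟩
      exact marking m _ hi x
    · rintro ⟨v, rfl⟩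
      exact ⟨_, BV m _ hi v⟩
  refine ⟨order, ?_, ?_⟩
  · exact AddMonoid.addOrderOf_eq_one_iff.1 (order 0)
  · have h2 := order 1
    rw [← Nat.card_zmultiples] at h2
    have e := zmodAddCyclicAddEquiv
      (G := AddSubgroup.zmultiples (eU 1 (((1 : ℕ) : ℤ) * (n - 1) + n) 1)) inferInstance
    rw [h2] at e
    exact ⟨e.symm⟩
end

section
/- For all integers i, j ≥ 1 one has the string bracket formula [e(a⊗u^i), e(a⊗u^j)] = −ij·e(1⊗u^{i+j−2}) in H_{(i+j−2)(n−1)+n}, and this bracket is zero if and only if (i+j−1) divides ij (this is Theorem 3.2(2), up to the overall sign convention). -/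
/-- String bracket of an odd sphere (Theorem 3.2(2)): for `i, j ≥ 1`,
`[e(a⊗uⁱ), e(a⊗uʲ)] = (-1)^{i(n-1)-n}·e(M(e(a⊗uⁱ))•M(e(a⊗uʲ))) = -ij·e(1⊗u^{i+j-2})`
in `H_{(i+j-2)(n-1)+n}`, and this bracket is zero iff `(i+j-1) ∣ ij`.
Here `M(e(a⊗uⁱ)) ∈ ℍ_{i(n-1)+1-n} = ℤ·(1⊗u^{i-1})` and the loop product multiplies
the coefficients: `(1⊗u^{i-1})•(1⊗u^{j-1}) = 1⊗u^{i+j-2}`. -/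
theorem stmt8
    (n : ℤ) (hodd : Odd n) (hn3 : 3 ≤ n)
    (H : ℤ → Type) [∀ i, AddCommGroup (H i)]
    -- H_i = 0 in negative degrees
    (hneg : ∀ i : ℤ, i < 0 → ∀ x : H i, x = 0)
    -- erasing maps on the pieces of ℍ = Λ[a]⊗ℤ[u]:  `eA m` is e on ℤ·(a⊗uᵐ) (meaningful
    -- at degree m(n-1)), `eU m` is e on ℤ·(1⊗uᵐ) (meaningful at degree m(n-1)+n)
    (eA : ℕ → ∀ i : ℤ, ℤ →+ H i)
    (eU : ℕ → ∀ i : ℤ, ℤ →+ H i)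
    -- marking maps into the pieces of ℍ:  `MA m` into ℤ·(a⊗uᵐ) (meaningful at degree
    -- m(n-1)-1), `MU m` into ℤ·(1⊗uᵐ) (meaningful at degree m(n-1)+n-1)
    (MA : ℕ → ∀ i : ℤ, H i →+ ℤ)
    (MU : ℕ → ∀ i : ℤ, H i →+ ℤ)
    -- cap product with the Euler class; c i j is only meaningful when j = i - 2
    (c : ∀ i j : ℤ, H i →+ H j)
    -- classes coming from H_*(ℂP^∞): ι m is meaningful at degree 2m
    (ι : ℕ → ∀ i : ℤ, ℤ →+ H i)
    -- exactness of ⋯ → ℍ_{i-n} →e→ H_i →c→ H_{i-2} →M→ ℍ_{i-n-1} →e→ H_{i-1} → ⋯ :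
    (hexA : ∀ m : ℕ, AddMonoidHom.range (eA m ((m : ℤ) * (n - 1))) =
      AddMonoidHom.ker (c ((m : ℤ) * (n - 1)) ((m : ℤ) * (n - 1) - 2)))
    (hexU : ∀ m : ℕ, AddMonoidHom.range (eU m ((m : ℤ) * (n - 1) + n)) =
      AddMonoidHom.ker (c ((m : ℤ) * (n - 1) + n) ((m : ℤ) * (n - 1) + n - 2)))
    (hcinj : ∀ i : ℤ, (∀ m : ℕ, i ≠ (m : ℤ) * (n - 1)) → (∀ m : ℕ, i ≠ (m : ℤ) * (n - 1) + n) →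
      Function.Injective (c i (i - 2)))
    (hexMU : ∀ m : ℕ, AddMonoidHom.range (c ((m : ℤ) * (n - 1) + n + 1) ((m : ℤ) * (n - 1) + n - 1)) =
      AddMonoidHom.ker (MU m ((m : ℤ) * (n - 1) + n - 1)))
    (hexMA : ∀ m : ℕ, AddMonoidHom.range (c ((m : ℤ) * (n - 1) + 1) ((m : ℤ) * (n - 1) - 1)) =
      AddMonoidHom.ker (MA m ((m : ℤ) * (n - 1) - 1)))
    (hcsurj : ∀ i : ℤ, (∀ m : ℕ, i ≠ (m : ℤ) * (n - 1) + n - 1) → (∀ m : ℕ, i ≠ (m : ℤ) * (n - 1) - 1) →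
      Function.Surjective (c (i + 2) i))
    (hkerA : ∀ m : ℕ, AddMonoidHom.ker (eA m ((m : ℤ) * (n - 1))) =
      AddMonoidHom.range (MA m ((m : ℤ) * (n - 1) - 1)))
    (hkerU : ∀ m : ℕ, AddMonoidHom.ker (eU m ((m : ℤ) * (n - 1) + n)) =
      AddMonoidHom.range (MU m ((m : ℤ) * (n - 1) + n - 1)))
    -- BV operator: M ∘ e = Δ with Δ(a⊗uᵐ) = m·(1⊗u^{m-1}) and Δ(1⊗uᵐ) = 0
    (hBVA : ∀ m : ℕ, 1 ≤ m → ∀ z : ℤ,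
      MU (m - 1) ((m : ℤ) * (n - 1)) (eA m ((m : ℤ) * (n - 1)) z) = (m : ℤ) * z)
    (hBVU : ∀ m m' : ℕ, (m' : ℤ) * (n - 1) - 1 = (m : ℤ) * (n - 1) + n → ∀ z : ℤ,
      MA m' ((m : ℤ) * (n - 1) + n) (eU m ((m : ℤ) * (n - 1) + n) z) = 0)
    -- ι₀ is an isomorphism, c ∘ ι = ι (one degree down), M ∘ ι = 0
    (hι0 : Function.Bijective (ι 0 0))
    (hιc : ∀ m : ℕ, 1 ≤ m → ∀ z : ℤ,
      c (2 * (m : ℤ)) (2 * (m : ℤ) - 2) (ι m (2 * (m : ℤ)) z) = ι (m - 1) (2 * (m : ℤ) - 2) z)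
    (hιM : ∀ m m' : ℕ, 2 * (m : ℤ) = (m' : ℤ) * (n - 1) + n - 1 → ∀ z : ℤ,
      MU m' (2 * (m : ℤ)) (ι m (2 * (m : ℤ)) z) = 0)
    :
    ∀ i j : ℕ, 1 ≤ i → 1 ≤ j →
      ((((-1 : ℤˣ) ^ ((i : ℤ) * (n - 1) - n) : ℤˣ) : ℤ) •
          eU (i + j - 2) (((i + j - 2 : ℕ) : ℤ) * (n - 1) + n)
            (MU (i - 1) ((i : ℤ) * (n - 1)) (eA i ((i : ℤ) * (n - 1)) 1) *
              MU (j - 1) ((j : ℤ) * (n - 1)) (eA j ((j : ℤ) * (n - 1)) 1))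
        = (-((i : ℤ) * (j : ℤ))) • eU (i + j - 2) (((i + j - 2 : ℕ) : ℤ) * (n - 1) + n) 1) ∧
      ((-((i : ℤ) * (j : ℤ))) • eU (i + j - 2) (((i + j - 2 : ℕ) : ℤ) * (n - 1) + n) 1 = 0 ↔
        ((i : ℤ) + (j : ℤ) - 1) ∣ ((i : ℤ) * (j : ℤ))) := by
  -- transport of the hypotheses along equalities of degrees
  have ker_c : ∀ (m : ℕ) (d : ℤ), d = (m : ℤ) * (n - 1) →
      AddMonoidHom.range (eA m d) = AddMonoidHom.ker (c d (d - 2)) := by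
    rintro m d rfl; exact hexA m
  have MU_c : ∀ (m : ℕ) (d d' : ℤ), d = (m : ℤ) * (n - 1) + n + 1 →
      d' = (m : ℤ) * (n - 1) + n - 1 → ∀ x : H d, MU m d' (c d d' x) = 0 := by
    rintro m d d' rfl rfl x
    have hx : c _ _ x ∈ AddMonoidHom.ker (MU m ((m : ℤ) * (n - 1) + n - 1)) :=
      hexMU m ▸ ⟨x, rfl⟩
    exact hx
  have MU_eA : ∀ (m : ℕ) (d : ℤ), d = ((m + 1 : ℕ) : ℤ) * (n - 1) → ∀ w : ℤ,
      MU m d (eA (m + 1) d w) = ((m + 1 : ℕ) : ℤ) * w := by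
    rintro m d rfl w
    exact hBVA (m + 1) (by omega) w
  have MU_ι : ∀ (k m : ℕ) (d : ℤ), d = 2 * (k : ℤ) → d = (m : ℤ) * (n - 1) + n - 1 →
      ∀ z : ℤ, MU m d (ι k d z) = 0 := by
    rintro k m d rfl h z
    exact hιM k m h z
  have c_ι : ∀ (k : ℕ) (d : ℤ), d = 2 * ((k + 1 : ℕ) : ℤ) → ∀ z : ℤ,
      c d (d - 2) (ι (k + 1) d z) = ι k (d - 2) z := by
    rintro k d rfl z
    exact hιc (k + 1) (by omega) z
  have ι_surj : ∀ d : ℤ, d = 0 → Function.Surjective (ι 0 d) := by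
    rintro d rfl; exact hι0.2
  -- in even degrees the kernel of `c` comes from the summands `ℤ·(a⊗uᵐ)` only
  have ker_c_even : ∀ (k : ℕ) (d : ℤ), d = 2 * (k : ℤ) → ∀ x : H d, c d (d - 2) x = 0 →
      x = 0 ∨ ∃ m : ℕ, d = (m : ℤ) * (n - 1) ∧ ∃ w, eA m d w = x := by
    intro k d hd x hx
    by_cases h : ∃ m : ℕ, d = (m : ℤ) * (n - 1)
    · obtain ⟨m, hm⟩ := h
      have hx' : x ∈ AddMonoidHom.range (eA m d) := by
        rw [ker_c m d hm]; exact hx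
      exact Or.inr ⟨m, hm, hx'⟩
    · left
      push Not at h
      refine hcinj d h (fun m hm => ?_) (hx.trans (map_zero _).symm)
      have : Even ((m : ℤ) * (n - 1)) := (hodd.sub_odd odd_one).mul_left _
      have hodd' : Odd d := hm ▸ this.add_odd hodd
      exact (Int.not_even_iff_odd.2 hodd') (hd ▸ even_two_mul _)
  -- modulo the kernel of `c`, every class of even degree comes from `ℂP^∞`
  have key : ∀ (k : ℕ) (d : ℤ), d = 2 * (k : ℤ) → ∀ x : H d,
      ∃ z, c d (d - 2) (x - ι k d z) = 0 := by
    intro k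
    induction k with
    | zero =>
      intro d hd x
      obtain ⟨z, rfl⟩ := ι_surj d (by simpa using hd) x
      exact ⟨z, by simp⟩
    | succ k ih =>
      intro d hd x
      suffices ∃ z, c d (d - 2) x = ι k (d - 2) z by
        obtain ⟨z, hz⟩ := this
        exact ⟨z, by rw [map_sub, hz, c_ι k d hd, sub_self]⟩
      have hd' : d - 2 = 2 * (k : ℤ) := by push_cast at hd; linarith
      obtain ⟨z, hz⟩ := ih (d - 2) hd' (c d (d - 2) x)
      rcases ker_c_even k (d - 2) hd' _ hz with h | ⟨m, hm, w, hw⟩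
      · exact ⟨z, sub_eq_zero.1 h⟩
      · cases m with
        | zero =>
          have hd0 : d - 2 = 0 := by simpa using hm
          obtain rfl : k = 0 := by omega
          obtain ⟨z', hz'⟩ := ι_surj (d - 2) hd0 (c d (d - 2) x)
          exact ⟨z', hz'.symm⟩
        | succ m =>
          have hm' : d - 2 = (m : ℤ) * (n - 1) + n - 1 := by
            rw [hm]; push_cast; ring
          have hmw := MU_eA m (d - 2) hm w
          rw [hw, map_sub, MU_c m d (d - 2) (by linarith) hm' x, MU_ι k m _ hd' hm', sub_zero,
            eq_comm, mul_eq_zero] at hmw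
          have hw0 : w = 0 := hmw.resolve_left (by positivity)
          rw [hw0, map_zero, eq_comm, sub_eq_zero] at hw
          exact ⟨z, hw⟩
  have dvd_MU : ∀ (m : ℕ) (d : ℤ), d = (m : ℤ) * (n - 1) + n - 1 → ∀ x : H d,
      ((m + 1 : ℕ) : ℤ) ∣ MU m d x := by
    intro m d hd x
    have hd' : d = ((m + 1 : ℕ) : ℤ) * (n - 1) := by rw [hd]; push_cast; ring
    obtain ⟨k, hk⟩ : ∃ k : ℕ, d = 2 * (k : ℤ) := by
      obtain ⟨r, hr⟩ := hodd
      refine ⟨(m + 1) * r.toNat, ?_⟩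
      have hr0 : 0 ≤ r := by omega
      rw [hd', hr]
      push_cast [Int.toNat_of_nonneg hr0]
      ring
    obtain ⟨z, hz⟩ := key k d hk x
    have hMx : MU m d (x - ι k d z) = MU m d x := by
      rw [map_sub, MU_ι k m d hk hd, sub_zero]
    rw [← hMx]
    rcases ker_c_even k d hk _ hz with h | ⟨m', hm', w, hw⟩
    · simp [h]
    · have hmm : m' = m + 1 := by
        have := mul_right_cancel₀ (by omega : n - 1 ≠ 0) (hm'.symm.trans hd')
        exact_mod_cast this
      subst hmm
      rw [← hw, MU_eA m d hd']
      exact dvd_mul_right _ _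
  have eU_eq_zero : ∀ (m : ℕ) (y : ℤ),
      eU m ((m : ℤ) * (n - 1) + n) y = 0 ↔ ((m + 1 : ℕ) : ℤ) ∣ y := by
    intro m y
    rw [← AddMonoidHom.mem_ker, hkerU m, AddMonoidHom.mem_range]
    constructor
    · rintro ⟨x, rfl⟩
      exact dvd_MU m _ rfl x
    · rintro ⟨w, rfl⟩
      exact ⟨eA (m + 1) _ w, MU_eA m _ (by push_cast; ring) w⟩
  intro i j hi hj
  have smul_eU : ∀ (m : ℕ) (d y : ℤ), y • eU m d 1 = eU m d y := by
    intro m d y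
    rw [← map_zsmul, smul_eq_mul, mul_one]
  constructor
  · have hsign : (-1 : ℤˣ) ^ ((i : ℤ) * (n - 1) - n) = -1 :=
      Int.negOnePow_odd _ (((hodd.sub_odd odd_one).mul_left _).sub_odd hodd)
    rw [hBVA i hi, hBVA j hj, hsign, smul_eU, ← map_zsmul]
    simp
  · rw [smul_eU, eU_eq_zero, dvd_neg,
      show ((i + j - 2 + 1 : ℕ) : ℤ) = (i : ℤ) + (j : ℤ) - 1 by omega]
end

section
/- If α ∈ H_p with p odd, then [α, β] = 0 for every q and every β ∈ H_q; that is, for odd spheres the string bracket vanishes whenever one of its arguments has odd degree, so the only possibly nonzero brackets are between the even-degree classes e(a⊗u^i). -/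
/-- For odd spheres the string bracket vanishes when one argument has odd degree:
the marking map kills every class of odd degree (the only odd degrees where `M` can be
nonzero are `m(n-1)-1`, into `ℤ·(a⊗uᵐ)`), and consequently
`[α,β] = (-1)^{p-n}·e(M(α)•M(β)) = 0` for `α` of odd degree `p = m₁(n-1)-1` and any `β`
(for `β` of degree `m₂(n-1)+n-1` the product `M(α)•M(β)` lies in `ℤ·(a⊗u^{m₁+m₂})` and is
erased by `eA (m₁+m₂)`; all other configurations are zero already in `ℍ`). -/
theorem stmt9
    (n : ℤ) (hodd : Odd n) (hn3 : 3 ≤ n)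
    (H : ℤ → Type) [∀ i, AddCommGroup (H i)]
    -- H_i = 0 in negative degrees
    (hneg : ∀ i : ℤ, i < 0 → ∀ x : H i, x = 0)
    -- erasing maps on the pieces of ℍ = Λ[a]⊗ℤ[u]:  `eA m` is e on ℤ·(a⊗uᵐ) (meaningful
    -- at degree m(n-1)), `eU m` is e on ℤ·(1⊗uᵐ) (meaningful at degree m(n-1)+n)
    (eA : ℕ → ∀ i : ℤ, ℤ →+ H i)
    (eU : ℕ → ∀ i : ℤ, ℤ →+ H i)
    -- marking maps into the pieces of ℍ:  `MA m` into ℤ·(a⊗uᵐ) (meaningful at degree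
    -- m(n-1)-1), `MU m` into ℤ·(1⊗uᵐ) (meaningful at degree m(n-1)+n-1)
    (MA : ℕ → ∀ i : ℤ, H i →+ ℤ)
    (MU : ℕ → ∀ i : ℤ, H i →+ ℤ)
    -- cap product with the Euler class; c i j is only meaningful when j = i - 2
    (c : ∀ i j : ℤ, H i →+ H j)
    -- classes coming from H_*(ℂP^∞): ι m is meaningful at degree 2m
    (ι : ℕ → ∀ i : ℤ, ℤ →+ H i)
    -- exactness of ⋯ → ℍ_{i-n} →e→ H_i →c→ H_{i-2} →M→ ℍ_{i-n-1} →e→ H_{i-1} → ⋯ :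
    (hexA : ∀ m : ℕ, AddMonoidHom.range (eA m ((m : ℤ) * (n - 1))) =
      AddMonoidHom.ker (c ((m : ℤ) * (n - 1)) ((m : ℤ) * (n - 1) - 2)))
    (hexU : ∀ m : ℕ, AddMonoidHom.range (eU m ((m : ℤ) * (n - 1) + n)) =
      AddMonoidHom.ker (c ((m : ℤ) * (n - 1) + n) ((m : ℤ) * (n - 1) + n - 2)))
    (hcinj : ∀ i : ℤ, (∀ m : ℕ, i ≠ (m : ℤ) * (n - 1)) → (∀ m : ℕ, i ≠ (m : ℤ) * (n - 1) + n) →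
      Function.Injective (c i (i - 2)))
    (hexMU : ∀ m : ℕ, AddMonoidHom.range (c ((m : ℤ) * (n - 1) + n + 1) ((m : ℤ) * (n - 1) + n - 1)) =
      AddMonoidHom.ker (MU m ((m : ℤ) * (n - 1) + n - 1)))
    (hexMA : ∀ m : ℕ, AddMonoidHom.range (c ((m : ℤ) * (n - 1) + 1) ((m : ℤ) * (n - 1) - 1)) =
      AddMonoidHom.ker (MA m ((m : ℤ) * (n - 1) - 1)))
    (hcsurj : ∀ i : ℤ, (∀ m : ℕ, i ≠ (m : ℤ) * (n - 1) + n - 1) → (∀ m : ℕ, i ≠ (m : ℤ) * (n - 1) - 1) →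
      Function.Surjective (c (i + 2) i))
    (hkerA : ∀ m : ℕ, AddMonoidHom.ker (eA m ((m : ℤ) * (n - 1))) =
      AddMonoidHom.range (MA m ((m : ℤ) * (n - 1) - 1)))
    (hkerU : ∀ m : ℕ, AddMonoidHom.ker (eU m ((m : ℤ) * (n - 1) + n)) =
      AddMonoidHom.range (MU m ((m : ℤ) * (n - 1) + n - 1)))
    -- BV operator: M ∘ e = Δ with Δ(a⊗uᵐ) = m·(1⊗u^{m-1}) and Δ(1⊗uᵐ) = 0
    (hBVA : ∀ m : ℕ, 1 ≤ m → ∀ z : ℤ,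
      MU (m - 1) ((m : ℤ) * (n - 1)) (eA m ((m : ℤ) * (n - 1)) z) = (m : ℤ) * z)
    (hBVU : ∀ m m' : ℕ, (m' : ℤ) * (n - 1) - 1 = (m : ℤ) * (n - 1) + n → ∀ z : ℤ,
      MA m' ((m : ℤ) * (n - 1) + n) (eU m ((m : ℤ) * (n - 1) + n) z) = 0)
    -- ι₀ is an isomorphism, c ∘ ι = ι (one degree down), M ∘ ι = 0
    (hι0 : Function.Bijective (ι 0 0))
    (hιc : ∀ m : ℕ, 1 ≤ m → ∀ z : ℤ,
      c (2 * (m : ℤ)) (2 * (m : ℤ) - 2) (ι m (2 * (m : ℤ)) z) = ι (m - 1) (2 * (m : ℤ) - 2) z)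
    (hιM : ∀ m m' : ℕ, 2 * (m : ℤ) = (m' : ℤ) * (n - 1) + n - 1 → ∀ z : ℤ,
      MU m' (2 * (m : ℤ)) (ι m (2 * (m : ℤ)) z) = 0)
    :
    (∀ m : ℕ, ∀ α : H ((m : ℤ) * (n - 1) - 1), MA m ((m : ℤ) * (n - 1) - 1) α = 0) ∧
      (∀ m₁ m₂ : ℕ, ∀ α : H ((m₁ : ℤ) * (n - 1) - 1), ∀ β : H ((m₂ : ℤ) * (n - 1) + n - 1),
        ((((-1 : ℤˣ) ^ ((m₁ : ℤ) * (n - 1) - 1 - n) : ℤˣ) : ℤ) •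
          eA (m₁ + m₂) (((m₁ + m₂ : ℕ) : ℤ) * (n - 1))
            (MA m₁ ((m₁ : ℤ) * (n - 1) - 1) α * MU m₂ ((m₂ : ℤ) * (n - 1) + n - 1) β)) = 0) := by
  have hMA : ∀ m : ℕ, ∀ α : H ((m : ℤ) * (n - 1) - 1), MA m ((m : ℤ) * (n - 1) - 1) α = 0 := by
    intro m α
    rcases Nat.eq_zero_or_pos m with rfl | hm
    · rw [hneg _ (by simp) α, map_zero]
    · have hker : MA m ((m : ℤ) * (n - 1) - 1) α ∈
          AddMonoidHom.ker (eA m ((m : ℤ) * (n - 1))) := by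
        rw [hkerA m]
        exact ⟨α, rfl⟩
      have hΔ := hBVA m hm (MA m ((m : ℤ) * (n - 1) - 1) α)
      rw [AddMonoidHom.mem_ker.mp hker, map_zero] at hΔ
      exact (mul_eq_zero.mp hΔ.symm).resolve_left (by exact_mod_cast hm.ne')
  refine ⟨hMA, fun m₁ m₂ α β => ?_⟩
  rw [hMA, zero_mul, map_zero, smul_zero]
end

section
/- For every integer j with 0 ≤ j ≤ n/2 − 1, one has H_{2j} ≅ ℤ (this is the low even-degree part of Theorem 3.1(3) for even spheres). -/
/-- Low even-degree string homology of an even sphere `Sⁿ` (Theorem 3.1(3)):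
for every integer `j` with `0 ≤ j ≤ n/2 - 1`, `H_{2j} ≅ ℤ`. -/
theorem stmt10
    (n : ℤ) (heven : Even n) (hn4 : 4 ≤ n)
    (H : ℤ → Type) [∀ i, AddCommGroup (H i)]
    -- H_i = 0 in negative degrees
    (hneg : ∀ i : ℤ, i < 0 → ∀ x : H i, x = 0)
    -- erasing maps on the pieces of ℍ = Λ(b)⊗ℤ[a,v]/(a²,ab,2av):
    -- `eV k` on ℤ·vᵏ (meaningful at degree k(2n-2)+n), `eB k` on ℤ·(bvᵏ) (at k(2n-2)+n-1),
    -- `ea` on ℤ·a (at degree 0), `eAV k` on (ℤ/2)·(avᵏ), k ≥ 1 (at degree k(2n-2))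
    (eV : ℕ → ∀ i : ℤ, ℤ →+ H i)
    (eB : ℕ → ∀ i : ℤ, ℤ →+ H i)
    (ea : ℤ →+ H 0)
    (eAV : ℕ → ∀ i : ℤ, ZMod 2 →+ H i)
    -- marking maps into the pieces of ℍ: `MV k` into ℤ·vᵏ (meaningful at degree k(2n-2)+n-1),
    -- `MB k` into ℤ·(bvᵏ) (at k(2n-2)+n-2), `MAV k` into (ℤ/2)·(avᵏ), k ≥ 1 (at k(2n-2)-1)
    (MV : ℕ → ∀ i : ℤ, H i →+ ℤ)
    (MB : ℕ → ∀ i : ℤ, H i →+ ℤ)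
    (MAV : ℕ → ∀ i : ℤ, H i →+ ZMod 2)
    -- cap product with the Euler class; c i j is only meaningful when j = i - 2
    (c : ∀ i j : ℤ, H i →+ H j)
    -- classes coming from H_*(ℂP^∞): ι m is meaningful at degree 2m
    (ι : ℕ → ∀ i : ℤ, ℤ →+ H i)
    -- exactness of ⋯ → ℍ_{i-n} →e→ H_i →c→ H_{i-2} →M→ ℍ_{i-n-1} →e→ H_{i-1} → ⋯ :
    (hexV : ∀ k : ℕ, AddMonoidHom.range (eV k ((k : ℤ) * (2 * n - 2) + n)) =
      AddMonoidHom.ker (c ((k : ℤ) * (2 * n - 2) + n) ((k : ℤ) * (2 * n - 2) + n - 2)))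
    (hexB : ∀ k : ℕ, AddMonoidHom.range (eB k ((k : ℤ) * (2 * n - 2) + n - 1)) =
      AddMonoidHom.ker (c ((k : ℤ) * (2 * n - 2) + n - 1) ((k : ℤ) * (2 * n - 2) + n - 3)))
    (hexa : AddMonoidHom.range ea = AddMonoidHom.ker (c 0 (-2)))
    (hexAV : ∀ k : ℕ, 1 ≤ k → AddMonoidHom.range (eAV k ((k : ℤ) * (2 * n - 2))) =
      AddMonoidHom.ker (c ((k : ℤ) * (2 * n - 2)) ((k : ℤ) * (2 * n - 2) - 2)))
    (hcinj : ∀ i : ℤ, (∀ k : ℕ, i ≠ (k : ℤ) * (2 * n - 2) + n) →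
      (∀ k : ℕ, i ≠ (k : ℤ) * (2 * n - 2) + n - 1) → i ≠ 0 →
      (∀ k : ℕ, 1 ≤ k → i ≠ (k : ℤ) * (2 * n - 2)) → Function.Injective (c i (i - 2)))
    (hexMV : ∀ k : ℕ,
      AddMonoidHom.range (c ((k : ℤ) * (2 * n - 2) + n + 1) ((k : ℤ) * (2 * n - 2) + n - 1)) =
      AddMonoidHom.ker (MV k ((k : ℤ) * (2 * n - 2) + n - 1)))
    (hexMB : ∀ k : ℕ,
      AddMonoidHom.range (c ((k : ℤ) * (2 * n - 2) + n) ((k : ℤ) * (2 * n - 2) + n - 2)) =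
      AddMonoidHom.ker (MB k ((k : ℤ) * (2 * n - 2) + n - 2)))
    (hexMAV : ∀ k : ℕ, 1 ≤ k →
      AddMonoidHom.range (c ((k : ℤ) * (2 * n - 2) + 1) ((k : ℤ) * (2 * n - 2) - 1)) =
      AddMonoidHom.ker (MAV k ((k : ℤ) * (2 * n - 2) - 1)))
    (hcsurj : ∀ i : ℤ, (∀ k : ℕ, i ≠ (k : ℤ) * (2 * n - 2) + n - 1) →
      (∀ k : ℕ, i ≠ (k : ℤ) * (2 * n - 2) + n - 2) →
      (∀ k : ℕ, 1 ≤ k → i ≠ (k : ℤ) * (2 * n - 2) - 1) → Function.Surjective (c (i + 2) i))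
    (hkerV : ∀ k : ℕ, AddMonoidHom.ker (eV k ((k : ℤ) * (2 * n - 2) + n)) =
      AddMonoidHom.range (MV k ((k : ℤ) * (2 * n - 2) + n - 1)))
    (hkerB : ∀ k : ℕ, AddMonoidHom.ker (eB k ((k : ℤ) * (2 * n - 2) + n - 1)) =
      AddMonoidHom.range (MB k ((k : ℤ) * (2 * n - 2) + n - 2)))
    (hkera : Function.Injective ea)
    (hkerAV : ∀ k : ℕ, 1 ≤ k → AddMonoidHom.ker (eAV k ((k : ℤ) * (2 * n - 2))) =
      AddMonoidHom.range (MAV k ((k : ℤ) * (2 * n - 2) - 1)))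
    -- BV operator: M ∘ e = Δ with Δ(vᵏ) = 0, Δ(avᵏ) = 0, Δ(bvᵏ) = (2k+1)·vᵏ
    -- (the composites M ∘ e corresponding to Δ(vᵏ) and Δ(avᵏ) land in zero groups)
    (hBV : ∀ k : ℕ, ∀ z : ℤ, MV k ((k : ℤ) * (2 * n - 2) + n - 1)
      (eB k ((k : ℤ) * (2 * n - 2) + n - 1) z) = (2 * (k : ℤ) + 1) * z)
    -- ι₀ is an isomorphism, c ∘ ι = ι (one degree down), M ∘ ι = 0
    (hι0 : Function.Bijective (ι 0 0))
    (hιc : ∀ m : ℕ, 1 ≤ m → ∀ z : ℤ,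
      c (2 * (m : ℤ)) (2 * (m : ℤ) - 2) (ι m (2 * (m : ℤ)) z) = ι (m - 1) (2 * (m : ℤ) - 2) z)
    (hιM : ∀ m k : ℕ, 2 * (m : ℤ) = (k : ℤ) * (2 * n - 2) + n - 2 → ∀ z : ℤ,
      MB k (2 * (m : ℤ)) (ι m (2 * (m : ℤ)) z) = 0)
    :
    ∀ j : ℤ, 0 ≤ j → j ≤ n / 2 - 1 → Nonempty (H (2 * j) ≃+ ℤ) := by
  have step : ∀ j : ℤ, 0 ≤ j → 2 * j + 2 ≤ n - 2 → Nonempty (H (2 * (j + 1)) ≃+ H (2 * j)) := by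
    intro j hj0 hj
    have hpos (k : ℕ) : 0 ≤ (k : ℤ) * (2 * n - 2) :=
      mul_nonneg (Int.natCast_nonneg k) (by lia)
    have hge (k : ℕ) (hk : 1 ≤ k) : 2 * n - 2 ≤ (k : ℤ) * (2 * n - 2) :=
      le_mul_of_one_le_left (by lia) (by exact_mod_cast hk)
    have hinj := hcinj (2 * j + 2) (fun k => by have := hpos k; lia)
      (fun k => by have := hpos k; lia) (by lia) (fun k hk => by have := hge k hk; lia)
    rw [add_sub_cancel_right] at hinj
    have hsurj := hcsurj (2 * j) (fun k => by have := hpos k; lia)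
      (fun k => by have := hpos k; lia) (fun k hk => by have := hge k hk; lia)
    rw [mul_add, mul_one]
    exact ⟨AddEquiv.ofBijective (c (2 * j + 2) (2 * j)) ⟨hinj, hsurj⟩⟩
  intro j hj0
  induction j, hj0 using Int.leInduction with
  | base => exact fun _ => ⟨(AddEquiv.ofBijective (ι 0 0) hι0).symm⟩
  | succ j hj0 ih =>
    intro hj
    obtain ⟨e⟩ := ih (by lia)
    obtain ⟨f⟩ := step j hj0 (by lia)
    exact ⟨f.trans e⟩
end

section
/- For every integer k ≥ 0, the map e : ℍ_{k(2n−2)−1} = ℤ·(bv^k) → H_{k(2n−2)+n−1} is an isomorphism; in particular H_{k(2n−2)+n−1} ≅ ℤ, generated by e(bv^k) (this is the nonvanishing odd-degree part of Theorem 3.1(3) for even spheres). -/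
/-- For every `k ≥ 0`, the erasing map `e : ℍ_{k(2n-2)-1} = ℤ·(bvᵏ) → H_{k(2n-2)+n-1}` is an
isomorphism; in particular `H_{k(2n-2)+n-1} ≅ ℤ`, generated by `e(bvᵏ)` (Theorem 3.1(3)). -/
theorem stmt11
    (n : ℤ) (heven : Even n) (hn4 : 4 ≤ n)
    (H : ℤ → Type) [∀ i, AddCommGroup (H i)]
    -- H_i = 0 in negative degrees
    (hneg : ∀ i : ℤ, i < 0 → ∀ x : H i, x = 0)
    -- erasing maps on the pieces of ℍ = Λ(b)⊗ℤ[a,v]/(a²,ab,2av):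
    -- `eV k` on ℤ·vᵏ (meaningful at degree k(2n-2)+n), `eB k` on ℤ·(bvᵏ) (at k(2n-2)+n-1),
    -- `ea` on ℤ·a (at degree 0), `eAV k` on (ℤ/2)·(avᵏ), k ≥ 1 (at degree k(2n-2))
    (eV : ℕ → ∀ i : ℤ, ℤ →+ H i)
    (eB : ℕ → ∀ i : ℤ, ℤ →+ H i)
    (ea : ℤ →+ H 0)
    (eAV : ℕ → ∀ i : ℤ, ZMod 2 →+ H i)
    -- marking maps into the pieces of ℍ: `MV k` into ℤ·vᵏ (meaningful at degree k(2n-2)+n-1),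
    -- `MB k` into ℤ·(bvᵏ) (at k(2n-2)+n-2), `MAV k` into (ℤ/2)·(avᵏ), k ≥ 1 (at k(2n-2)-1)
    (MV : ℕ → ∀ i : ℤ, H i →+ ℤ)
    (MB : ℕ → ∀ i : ℤ, H i →+ ℤ)
    (MAV : ℕ → ∀ i : ℤ, H i →+ ZMod 2)
    -- cap product with the Euler class; c i j is only meaningful when j = i - 2
    (c : ∀ i j : ℤ, H i →+ H j)
    -- classes coming from H_*(ℂP^∞): ι m is meaningful at degree 2m
    (ι : ℕ → ∀ i : ℤ, ℤ →+ H i)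
    -- exactness of ⋯ → ℍ_{i-n} →e→ H_i →c→ H_{i-2} →M→ ℍ_{i-n-1} →e→ H_{i-1} → ⋯ :
    (hexV : ∀ k : ℕ, AddMonoidHom.range (eV k ((k : ℤ) * (2 * n - 2) + n)) =
      AddMonoidHom.ker (c ((k : ℤ) * (2 * n - 2) + n) ((k : ℤ) * (2 * n - 2) + n - 2)))
    (hexB : ∀ k : ℕ, AddMonoidHom.range (eB k ((k : ℤ) * (2 * n - 2) + n - 1)) =
      AddMonoidHom.ker (c ((k : ℤ) * (2 * n - 2) + n - 1) ((k : ℤ) * (2 * n - 2) + n - 3)))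
    (hexa : AddMonoidHom.range ea = AddMonoidHom.ker (c 0 (-2)))
    (hexAV : ∀ k : ℕ, 1 ≤ k → AddMonoidHom.range (eAV k ((k : ℤ) * (2 * n - 2))) =
      AddMonoidHom.ker (c ((k : ℤ) * (2 * n - 2)) ((k : ℤ) * (2 * n - 2) - 2)))
    (hcinj : ∀ i : ℤ, (∀ k : ℕ, i ≠ (k : ℤ) * (2 * n - 2) + n) →
      (∀ k : ℕ, i ≠ (k : ℤ) * (2 * n - 2) + n - 1) → i ≠ 0 →
      (∀ k : ℕ, 1 ≤ k → i ≠ (k : ℤ) * (2 * n - 2)) → Function.Injective (c i (i - 2)))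
    (hexMV : ∀ k : ℕ,
      AddMonoidHom.range (c ((k : ℤ) * (2 * n - 2) + n + 1) ((k : ℤ) * (2 * n - 2) + n - 1)) =
      AddMonoidHom.ker (MV k ((k : ℤ) * (2 * n - 2) + n - 1)))
    (hexMB : ∀ k : ℕ,
      AddMonoidHom.range (c ((k : ℤ) * (2 * n - 2) + n) ((k : ℤ) * (2 * n - 2) + n - 2)) =
      AddMonoidHom.ker (MB k ((k : ℤ) * (2 * n - 2) + n - 2)))
    (hexMAV : ∀ k : ℕ, 1 ≤ k →
      AddMonoidHom.range (c ((k : ℤ) * (2 * n - 2) + 1) ((k : ℤ) * (2 * n - 2) - 1)) =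
      AddMonoidHom.ker (MAV k ((k : ℤ) * (2 * n - 2) - 1)))
    (hcsurj : ∀ i : ℤ, (∀ k : ℕ, i ≠ (k : ℤ) * (2 * n - 2) + n - 1) →
      (∀ k : ℕ, i ≠ (k : ℤ) * (2 * n - 2) + n - 2) →
      (∀ k : ℕ, 1 ≤ k → i ≠ (k : ℤ) * (2 * n - 2) - 1) → Function.Surjective (c (i + 2) i))
    (hkerV : ∀ k : ℕ, AddMonoidHom.ker (eV k ((k : ℤ) * (2 * n - 2) + n)) =
      AddMonoidHom.range (MV k ((k : ℤ) * (2 * n - 2) + n - 1)))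
    (hkerB : ∀ k : ℕ, AddMonoidHom.ker (eB k ((k : ℤ) * (2 * n - 2) + n - 1)) =
      AddMonoidHom.range (MB k ((k : ℤ) * (2 * n - 2) + n - 2)))
    (hkera : Function.Injective ea)
    (hkerAV : ∀ k : ℕ, 1 ≤ k → AddMonoidHom.ker (eAV k ((k : ℤ) * (2 * n - 2))) =
      AddMonoidHom.range (MAV k ((k : ℤ) * (2 * n - 2) - 1)))
    -- BV operator: M ∘ e = Δ with Δ(vᵏ) = 0, Δ(avᵏ) = 0, Δ(bvᵏ) = (2k+1)·vᵏ
    -- (the composites M ∘ e corresponding to Δ(vᵏ) and Δ(avᵏ) land in zero groups)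
    (hBV : ∀ k : ℕ, ∀ z : ℤ, MV k ((k : ℤ) * (2 * n - 2) + n - 1)
      (eB k ((k : ℤ) * (2 * n - 2) + n - 1) z) = (2 * (k : ℤ) + 1) * z)
    -- ι₀ is an isomorphism, c ∘ ι = ι (one degree down), M ∘ ι = 0
    (hι0 : Function.Bijective (ι 0 0))
    (hιc : ∀ m : ℕ, 1 ≤ m → ∀ z : ℤ,
      c (2 * (m : ℤ)) (2 * (m : ℤ) - 2) (ι m (2 * (m : ℤ)) z) = ι (m - 1) (2 * (m : ℤ) - 2) z)
    (hιM : ∀ m k : ℕ, 2 * (m : ℤ) = (k : ℤ) * (2 * n - 2) + n - 2 → ∀ z : ℤ,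
      MB k (2 * (m : ℤ)) (ι m (2 * (m : ℤ)) z) = 0)
    :
    ∀ k : ℕ, Function.Bijective (eB k ((k : ℤ) * (2 * n - 2) + n - 1)) ∧
      Nonempty (H ((k : ℤ) * (2 * n - 2) + n - 1) ≃+ ℤ) := by
  have hN : Even (2 * n - 2) := ⟨n - 1, by ring⟩
  have hexB' : ∀ (k : ℕ) (i j : ℤ), i = k * (2 * n - 2) + n - 1 → j = k * (2 * n - 2) + n - 3 →
      (∀ y : H j, y = 0) → ∀ x : H i, ∃ z, eB k i z = x := by
    rintro k i j rfl rfl hj x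
    have hx : x ∈ (c (k * (2 * n - 2) + n - 1) (k * (2 * n - 2) + n - 3)).ker := hj _
    rwa [← hexB k] at hx
  have hMVc : ∀ (k : ℕ) (i j : ℤ), i = k * (2 * n - 2) + n + 1 → j = k * (2 * n - 2) + n - 1 →
      ∀ x : H i, MV k j (c i j x) = 0 := by
    rintro k i j rfl rfl x
    rw [← AddMonoidHom.mem_ker, ← hexMV k]
    exact ⟨x, rfl⟩
  have hBV' : ∀ (k : ℕ) (i : ℤ), i = k * (2 * n - 2) + n - 1 →
      ∀ z, MV k i (eB k i z) = 0 → z = 0 := by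
    rintro k i rfl z hz
    rw [hBV] at hz
    rcases mul_eq_zero.1 hz with h | h
    · omega
    · exact h
  have hgap : ∀ k j : ℕ, (k : ℤ) * (2 * n - 2) + n - 3 ≠ j * (2 * n - 2) + n - 1 := by
    intro k j h
    rcases lt_or_ge (j : ℤ) k with hjk | hjk <;> nlinarith
  -- The odd-degree groups away from the degrees of the classes `e(bvᵏ)` vanish.
  have hvanish : ∀ (m : ℕ) (i : ℤ), i < m → Odd i → (∀ k : ℕ, i ≠ k * (2 * n - 2) + n - 1) →
      ∀ x : H i, x = 0 := by
    intro m
    induction m using Nat.strong_induction_on with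
    | _ m ih =>
    intro i him hodd hi x
    rcases lt_or_ge i 0 with hi0 | hi0
    · exact hneg i hi0 x
    have hinj : Function.Injective (c i (i - 2)) := by
      refine hcinj i (fun k h => ?_) hi (fun h => ?_) (fun k _ h => ?_) <;>
        refine Int.not_even_iff_odd.2 hodd ?_ <;> rw [h]
      · exact (hN.mul_left _).add heven
      · exact Even.zero
      · exact hN.mul_left _
    have hodd' : ∀ j : ℤ, Even j → Odd (i - j) := fun j hj => hodd.sub_even hj
    apply (injective_iff_map_eq_zero _).1 hinj
    by_cases h : ∃ k : ℕ, i - 2 = k * (2 * n - 2) + n - 1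
    · obtain ⟨k, hk⟩ := h
      obtain ⟨z, hz⟩ := hexB' k (i - 2) (i - 4) hk (by linarith)
        (ih (m - 1) (by omega) (i - 4) (by omega) (hodd' 4 (by decide))
          fun j hj => hgap k j (by linarith)) (c i (i - 2) x)
      have hM := hMVc k i (i - 2) (by linarith) hk x
      rw [← hz] at hM
      rw [← hz, hBV' k _ hk z hM, map_zero]
    · exact ih (m - 1) (by omega) (i - 2) (by omega) (hodd' 2 even_two)
        (fun k hk => h ⟨k, hk⟩) _
  intro k
  have hbij : Function.Bijective (eB k ((k : ℤ) * (2 * n - 2) + n - 1)) := by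
    constructor
    · rw [injective_iff_map_eq_zero]
      intro z hz
      exact hBV' k _ rfl z (by rw [hz, map_zero])
    · refine hexB' k _ _ rfl rfl (hvanish (((k : ℤ) * (2 * n - 2) + n - 3).toNat + 1) _ ?_ ?_
        (hgap k))
      · have := Int.self_le_toNat ((k : ℤ) * (2 * n - 2) + n - 3)
        push_cast
        linarith
      · exact ((hN.mul_left _).add heven).sub_odd (by decide)
  exact ⟨hbij, ⟨(AddEquiv.ofBijective _ hbij).symm⟩⟩
end

section
/- For every odd integer i ≥ 0 with i not congruent to n−1 modulo 2n−2, one has H_i = 0; that is, all odd-degree string homology of an even sphere vanishes except in the degrees k(2n−2)+n−1, k ≥ 0 (this is the vanishing odd-degree part of Theorem 3.1(3) for even spheres). -/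
/-- Vanishing odd-degree string homology of an even sphere (Theorem 3.1(3)): for every odd
`i ≥ 0` not of the form `k(2n-2)+n-1`, `H_i = 0`. -/
theorem stmt12
    (n : ℤ) (heven : Even n) (hn4 : 4 ≤ n)
    (H : ℤ → Type) [∀ i, AddCommGroup (H i)]
    -- H_i = 0 in negative degrees
    (hneg : ∀ i : ℤ, i < 0 → ∀ x : H i, x = 0)
    -- erasing maps on the pieces of ℍ = Λ(b)⊗ℤ[a,v]/(a²,ab,2av):
    -- `eV k` on ℤ·vᵏ (meaningful at degree k(2n-2)+n), `eB k` on ℤ·(bvᵏ) (at k(2n-2)+n-1),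
    -- `ea` on ℤ·a (at degree 0), `eAV k` on (ℤ/2)·(avᵏ), k ≥ 1 (at degree k(2n-2))
    (eV : ℕ → ∀ i : ℤ, ℤ →+ H i)
    (eB : ℕ → ∀ i : ℤ, ℤ →+ H i)
    (ea : ℤ →+ H 0)
    (eAV : ℕ → ∀ i : ℤ, ZMod 2 →+ H i)
    -- marking maps into the pieces of ℍ: `MV k` into ℤ·vᵏ (meaningful at degree k(2n-2)+n-1),
    -- `MB k` into ℤ·(bvᵏ) (at k(2n-2)+n-2), `MAV k` into (ℤ/2)·(avᵏ), k ≥ 1 (at k(2n-2)-1)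
    (MV : ℕ → ∀ i : ℤ, H i →+ ℤ)
    (MB : ℕ → ∀ i : ℤ, H i →+ ℤ)
    (MAV : ℕ → ∀ i : ℤ, H i →+ ZMod 2)
    -- cap product with the Euler class; c i j is only meaningful when j = i - 2
    (c : ∀ i j : ℤ, H i →+ H j)
    -- classes coming from H_*(ℂP^∞): ι m is meaningful at degree 2m
    (ι : ℕ → ∀ i : ℤ, ℤ →+ H i)
    -- exactness of ⋯ → ℍ_{i-n} →e→ H_i →c→ H_{i-2} →M→ ℍ_{i-n-1} →e→ H_{i-1} → ⋯ :
    (hexV : ∀ k : ℕ, AddMonoidHom.range (eV k ((k : ℤ) * (2 * n - 2) + n)) =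
      AddMonoidHom.ker (c ((k : ℤ) * (2 * n - 2) + n) ((k : ℤ) * (2 * n - 2) + n - 2)))
    (hexB : ∀ k : ℕ, AddMonoidHom.range (eB k ((k : ℤ) * (2 * n - 2) + n - 1)) =
      AddMonoidHom.ker (c ((k : ℤ) * (2 * n - 2) + n - 1) ((k : ℤ) * (2 * n - 2) + n - 3)))
    (hexa : AddMonoidHom.range ea = AddMonoidHom.ker (c 0 (-2)))
    (hexAV : ∀ k : ℕ, 1 ≤ k → AddMonoidHom.range (eAV k ((k : ℤ) * (2 * n - 2))) =
      AddMonoidHom.ker (c ((k : ℤ) * (2 * n - 2)) ((k : ℤ) * (2 * n - 2) - 2)))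
    (hcinj : ∀ i : ℤ, (∀ k : ℕ, i ≠ (k : ℤ) * (2 * n - 2) + n) →
      (∀ k : ℕ, i ≠ (k : ℤ) * (2 * n - 2) + n - 1) → i ≠ 0 →
      (∀ k : ℕ, 1 ≤ k → i ≠ (k : ℤ) * (2 * n - 2)) → Function.Injective (c i (i - 2)))
    (hexMV : ∀ k : ℕ,
      AddMonoidHom.range (c ((k : ℤ) * (2 * n - 2) + n + 1) ((k : ℤ) * (2 * n - 2) + n - 1)) =
      AddMonoidHom.ker (MV k ((k : ℤ) * (2 * n - 2) + n - 1)))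
    (hexMB : ∀ k : ℕ,
      AddMonoidHom.range (c ((k : ℤ) * (2 * n - 2) + n) ((k : ℤ) * (2 * n - 2) + n - 2)) =
      AddMonoidHom.ker (MB k ((k : ℤ) * (2 * n - 2) + n - 2)))
    (hexMAV : ∀ k : ℕ, 1 ≤ k →
      AddMonoidHom.range (c ((k : ℤ) * (2 * n - 2) + 1) ((k : ℤ) * (2 * n - 2) - 1)) =
      AddMonoidHom.ker (MAV k ((k : ℤ) * (2 * n - 2) - 1)))
    (hcsurj : ∀ i : ℤ, (∀ k : ℕ, i ≠ (k : ℤ) * (2 * n - 2) + n - 1) →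
      (∀ k : ℕ, i ≠ (k : ℤ) * (2 * n - 2) + n - 2) →
      (∀ k : ℕ, 1 ≤ k → i ≠ (k : ℤ) * (2 * n - 2) - 1) → Function.Surjective (c (i + 2) i))
    (hkerV : ∀ k : ℕ, AddMonoidHom.ker (eV k ((k : ℤ) * (2 * n - 2) + n)) =
      AddMonoidHom.range (MV k ((k : ℤ) * (2 * n - 2) + n - 1)))
    (hkerB : ∀ k : ℕ, AddMonoidHom.ker (eB k ((k : ℤ) * (2 * n - 2) + n - 1)) =
      AddMonoidHom.range (MB k ((k : ℤ) * (2 * n - 2) + n - 2)))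
    (hkera : Function.Injective ea)
    (hkerAV : ∀ k : ℕ, 1 ≤ k → AddMonoidHom.ker (eAV k ((k : ℤ) * (2 * n - 2))) =
      AddMonoidHom.range (MAV k ((k : ℤ) * (2 * n - 2) - 1)))
    -- BV operator: M ∘ e = Δ with Δ(vᵏ) = 0, Δ(avᵏ) = 0, Δ(bvᵏ) = (2k+1)·vᵏ
    -- (the composites M ∘ e corresponding to Δ(vᵏ) and Δ(avᵏ) land in zero groups)
    (hBV : ∀ k : ℕ, ∀ z : ℤ, MV k ((k : ℤ) * (2 * n - 2) + n - 1)
      (eB k ((k : ℤ) * (2 * n - 2) + n - 1) z) = (2 * (k : ℤ) + 1) * z)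
    -- ι₀ is an isomorphism, c ∘ ι = ι (one degree down), M ∘ ι = 0
    (hι0 : Function.Bijective (ι 0 0))
    (hιc : ∀ m : ℕ, 1 ≤ m → ∀ z : ℤ,
      c (2 * (m : ℤ)) (2 * (m : ℤ) - 2) (ι m (2 * (m : ℤ)) z) = ι (m - 1) (2 * (m : ℤ) - 2) z)
    (hιM : ∀ m k : ℕ, 2 * (m : ℤ) = (k : ℤ) * (2 * n - 2) + n - 2 → ∀ z : ℤ,
      MB k (2 * (m : ℤ)) (ι m (2 * (m : ℤ)) z) = 0)
    :
    ∀ i : ℤ, 0 ≤ i → Odd i → (∀ k : ℕ, i ≠ (k : ℤ) * (2 * n - 2) + n - 1) →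
      ∀ x : H i, x = 0 := by
  have inj : ∀ i : ℤ, Odd i → (∀ k : ℕ, i ≠ (k : ℤ) * (2 * n - 2) + n - 1) →
      Function.Injective (c i (i - 2)) := by
    intro i hodd hi
    have hmul (k : ℕ) : Even ((k : ℤ) * (2 * n - 2)) :=
      Even.mul_left ⟨n - 1, by ring⟩ _
    refine hcinj i (fun k h => ?_) hi ?_ (fun k _ h => ?_)
    · exact Int.not_even_iff_odd.2 hodd (h ▸ (hmul k).add heven)
    · rintro rfl
      exact Int.not_even_iff_odd.2 hodd Even.zero
    · exact Int.not_even_iff_odd.2 hodd (h ▸ hmul k)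
  have vanish : ∀ m : ℕ, ∀ i : ℤ, i < m → Odd i →
      (∀ k : ℕ, i ≠ (k : ℤ) * (2 * n - 2) + n - 1) → ∀ x : H i, x = 0 := by
    intro m
    induction m with
    | zero => exact fun i hi _ _ => hneg i (by simpa using hi)
    | succ m ih =>
      intro i hi hodd hne x
      push_cast at hi
      have hinj := inj i hodd hne
      by_cases hk : ∃ k : ℕ, i - 2 = (k : ℤ) * (2 * n - 2) + n - 1
      · obtain ⟨k, hk⟩ := hk
        obtain rfl : i = (k : ℤ) * (2 * n - 2) + n + 1 := by linarith
        rw [hk] at hinj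
        have hprev : ∀ y : H ((k : ℤ) * (2 * n - 2) + n - 3), y = 0 := by
          refine ih _ (by linarith) ?_ fun j hj => ?_
          · obtain ⟨r, hr⟩ := hodd
            exact ⟨r - 2, by linarith⟩
          · have hdvd : n - 1 ∣ 1 := ⟨(k : ℤ) - j, by linarith⟩
            linarith [Int.le_of_dvd one_pos hdvd]
        obtain ⟨z, hz⟩ : c _ ((k : ℤ) * (2 * n - 2) + n - 1) x ∈
            (eB k ((k : ℤ) * (2 * n - 2) + n - 1)).range := by
          rw [hexB k]
          exact hprev _
        have hM : MV k _ (c _ ((k : ℤ) * (2 * n - 2) + n - 1) x) = 0 := by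
          rw [← AddMonoidHom.mem_ker, ← hexMV k]
          exact ⟨x, rfl⟩
        rw [← hz, hBV] at hM
        have hz0 : z = 0 := (mul_eq_zero.1 hM).resolve_left (by omega)
        apply hinj
        rw [← hz, hz0, map_zero, map_zero]
      · push Not at hk
        apply hinj
        rw [map_zero]
        exact ih _ (by linarith) (hodd.sub_even even_two) hk _
  intro i hi hodd hne
  exact vanish (i.toNat + 1) i (by push_cast; rw [Int.toNat_of_nonneg hi]; exact lt_add_one i)
    hodd hne
end

section
/- For every integer k ≥ 1, the element e(v^k) ∈ H_{k(2n−2)+n} has order exactly 2k+1. -/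
/-- Multiples of an integer larger than `2` never differ by exactly `2`. -/
theorem mul_ne_mul_add_two {d : ℤ} (hd : 2 < d) (p q : ℤ) : p * d ≠ q * d + 2 := by
  intro h
  have : d ∣ 2 := ⟨p - q, by linear_combination -h⟩
  exact absurd (Int.le_of_dvd two_pos this) (not_le.mpr hd)

/-- Odd-degree vanishing in the Gysin sequence: if the kernel of `c` in odd degrees is concentrated
in the degrees `kd + n - 1`, where it is generated by classes `eB k z` detected by `MV k`, then the
odd groups vanish in all other degrees. -/
theorem odd_vanishing_of_gysin {n d : ℤ} (hd : 2 < d)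
    {H : ℤ → Type*} [∀ i, AddCommGroup (H i)]
    (hneg : ∀ i : ℤ, i < 0 → ∀ x : H i, x = 0)
    (eB : ℕ → ∀ i : ℤ, ℤ →+ H i) (MV : ℕ → ∀ i : ℤ, H i →+ ℤ) (c : ∀ i j : ℤ, H i →+ H j)
    (hexB : ∀ k : ℕ, (eB k (k * d + n - 1)).range = (c (k * d + n - 1) (k * d + n - 3)).ker)
    (hinj : ∀ i : ℤ, Odd i → (∀ k : ℕ, i ≠ k * d + n - 1) → Function.Injective (c i (i - 2)))
    (hexMV : ∀ k : ℕ, (c (k * d + n + 1) (k * d + n - 1)).range = (MV k (k * d + n - 1)).ker)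
    (hBV : ∀ k : ℕ, ∀ z : ℤ, MV k (k * d + n - 1) (eB k (k * d + n - 1) z) = (2 * (k : ℤ) + 1) * z)
    (i : ℤ) (hi : Odd i) (hik : ∀ k : ℕ, i ≠ k * d + n - 1) (x : H i) : x = 0 := by
  obtain ⟨N, hN⟩ : ∃ N : ℕ, i < N := ⟨i.toNat + 1, by omega⟩
  induction N generalizing i with
  | zero => exact hneg i (by simpa using hN) x
  | succ N ih =>
    have hodd : ∀ {j : ℤ}, Odd j → Odd (j - 2) := fun hj => hj.sub_even even_two
    by_cases hk : ∃ k : ℕ, i - 2 = k * d + n - 1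
    · obtain ⟨k, hk⟩ := hk
      obtain rfl : i = k * d + n + 1 := by linear_combination hk
      have hinj' : Function.Injective (c (k * d + n + 1) (k * d + n - 1)) :=
        hk ▸ hinj _ hi hik
      have hzero : ∀ y : H (k * d + n - 3), y = 0 := fun y => by
        refine ih _ ?_ (fun l hl => ?_) y (by push_cast at hN; linarith)
        · convert hodd (hodd hi) using 1; ring
        · exact mul_ne_mul_add_two hd k l (by linear_combination hl)
      have hker : c _ _ x ∈ (c (k * d + n - 1) (k * d + n - 3)).ker := hzero _
      rw [← hexB] at hker
      obtain ⟨z, hz⟩ := hker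
      have hM : c _ _ x ∈ (MV k (k * d + n - 1)).ker := hexMV k ▸ ⟨x, rfl⟩
      rw [AddMonoidHom.mem_ker, ← hz, hBV] at hM
      obtain rfl : z = 0 := (mul_eq_zero.mp hM).resolve_left (by omega)
      exact hinj' (by rw [← hz, map_zero, map_zero])
    · exact hinj i hi hik <|
        (ih (i - 2) (hodd hi) (not_exists.mp hk) _ (by push_cast at hN; linarith)).trans
          (map_zero _).symm

/-- For every `k ≥ 1`, the element `e(vᵏ) ∈ H_{k(2n-2)+n}` has order exactly `2k+1`. -/
theorem stmt13
    (n : ℤ) (heven : Even n) (hn4 : 4 ≤ n)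
    (H : ℤ → Type) [∀ i, AddCommGroup (H i)]
    -- H_i = 0 in negative degrees
    (hneg : ∀ i : ℤ, i < 0 → ∀ x : H i, x = 0)
    -- erasing maps on the pieces of ℍ = Λ(b)⊗ℤ[a,v]/(a²,ab,2av):
    -- `eV k` on ℤ·vᵏ (meaningful at degree k(2n-2)+n), `eB k` on ℤ·(bvᵏ) (at k(2n-2)+n-1),
    -- `ea` on ℤ·a (at degree 0), `eAV k` on (ℤ/2)·(avᵏ), k ≥ 1 (at degree k(2n-2))
    (eV : ℕ → ∀ i : ℤ, ℤ →+ H i)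
    (eB : ℕ → ∀ i : ℤ, ℤ →+ H i)
    (ea : ℤ →+ H 0)
    (eAV : ℕ → ∀ i : ℤ, ZMod 2 →+ H i)
    -- marking maps into the pieces of ℍ: `MV k` into ℤ·vᵏ (meaningful at degree k(2n-2)+n-1),
    -- `MB k` into ℤ·(bvᵏ) (at k(2n-2)+n-2), `MAV k` into (ℤ/2)·(avᵏ), k ≥ 1 (at k(2n-2)-1)
    (MV : ℕ → ∀ i : ℤ, H i →+ ℤ)
    (MB : ℕ → ∀ i : ℤ, H i →+ ℤ)
    (MAV : ℕ → ∀ i : ℤ, H i →+ ZMod 2)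
    -- cap product with the Euler class; c i j is only meaningful when j = i - 2
    (c : ∀ i j : ℤ, H i →+ H j)
    -- classes coming from H_*(ℂP^∞): ι m is meaningful at degree 2m
    (ι : ℕ → ∀ i : ℤ, ℤ →+ H i)
    -- exactness of ⋯ → ℍ_{i-n} →e→ H_i →c→ H_{i-2} →M→ ℍ_{i-n-1} →e→ H_{i-1} → ⋯ :
    (hexV : ∀ k : ℕ, AddMonoidHom.range (eV k ((k : ℤ) * (2 * n - 2) + n)) =
      AddMonoidHom.ker (c ((k : ℤ) * (2 * n - 2) + n) ((k : ℤ) * (2 * n - 2) + n - 2)))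
    (hexB : ∀ k : ℕ, AddMonoidHom.range (eB k ((k : ℤ) * (2 * n - 2) + n - 1)) =
      AddMonoidHom.ker (c ((k : ℤ) * (2 * n - 2) + n - 1) ((k : ℤ) * (2 * n - 2) + n - 3)))
    (hexa : AddMonoidHom.range ea = AddMonoidHom.ker (c 0 (-2)))
    (hexAV : ∀ k : ℕ, 1 ≤ k → AddMonoidHom.range (eAV k ((k : ℤ) * (2 * n - 2))) =
      AddMonoidHom.ker (c ((k : ℤ) * (2 * n - 2)) ((k : ℤ) * (2 * n - 2) - 2)))
    (hcinj : ∀ i : ℤ, (∀ k : ℕ, i ≠ (k : ℤ) * (2 * n - 2) + n) →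
      (∀ k : ℕ, i ≠ (k : ℤ) * (2 * n - 2) + n - 1) → i ≠ 0 →
      (∀ k : ℕ, 1 ≤ k → i ≠ (k : ℤ) * (2 * n - 2)) → Function.Injective (c i (i - 2)))
    (hexMV : ∀ k : ℕ,
      AddMonoidHom.range (c ((k : ℤ) * (2 * n - 2) + n + 1) ((k : ℤ) * (2 * n - 2) + n - 1)) =
      AddMonoidHom.ker (MV k ((k : ℤ) * (2 * n - 2) + n - 1)))
    (hexMB : ∀ k : ℕ,
      AddMonoidHom.range (c ((k : ℤ) * (2 * n - 2) + n) ((k : ℤ) * (2 * n - 2) + n - 2)) =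
      AddMonoidHom.ker (MB k ((k : ℤ) * (2 * n - 2) + n - 2)))
    (hexMAV : ∀ k : ℕ, 1 ≤ k →
      AddMonoidHom.range (c ((k : ℤ) * (2 * n - 2) + 1) ((k : ℤ) * (2 * n - 2) - 1)) =
      AddMonoidHom.ker (MAV k ((k : ℤ) * (2 * n - 2) - 1)))
    (hcsurj : ∀ i : ℤ, (∀ k : ℕ, i ≠ (k : ℤ) * (2 * n - 2) + n - 1) →
      (∀ k : ℕ, i ≠ (k : ℤ) * (2 * n - 2) + n - 2) →
      (∀ k : ℕ, 1 ≤ k → i ≠ (k : ℤ) * (2 * n - 2) - 1) → Function.Surjective (c (i + 2) i))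
    (hkerV : ∀ k : ℕ, AddMonoidHom.ker (eV k ((k : ℤ) * (2 * n - 2) + n)) =
      AddMonoidHom.range (MV k ((k : ℤ) * (2 * n - 2) + n - 1)))
    (hkerB : ∀ k : ℕ, AddMonoidHom.ker (eB k ((k : ℤ) * (2 * n - 2) + n - 1)) =
      AddMonoidHom.range (MB k ((k : ℤ) * (2 * n - 2) + n - 2)))
    (hkera : Function.Injective ea)
    (hkerAV : ∀ k : ℕ, 1 ≤ k → AddMonoidHom.ker (eAV k ((k : ℤ) * (2 * n - 2))) =
      AddMonoidHom.range (MAV k ((k : ℤ) * (2 * n - 2) - 1)))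
    -- BV operator: M ∘ e = Δ with Δ(vᵏ) = 0, Δ(avᵏ) = 0, Δ(bvᵏ) = (2k+1)·vᵏ
    -- (the composites M ∘ e corresponding to Δ(vᵏ) and Δ(avᵏ) land in zero groups)
    (hBV : ∀ k : ℕ, ∀ z : ℤ, MV k ((k : ℤ) * (2 * n - 2) + n - 1)
      (eB k ((k : ℤ) * (2 * n - 2) + n - 1) z) = (2 * (k : ℤ) + 1) * z)
    -- ι₀ is an isomorphism, c ∘ ι = ι (one degree down), M ∘ ι = 0
    (hι0 : Function.Bijective (ι 0 0))
    (hιc : ∀ m : ℕ, 1 ≤ m → ∀ z : ℤ,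
      c (2 * (m : ℤ)) (2 * (m : ℤ) - 2) (ι m (2 * (m : ℤ)) z) = ι (m - 1) (2 * (m : ℤ) - 2) z)
    (hιM : ∀ m k : ℕ, 2 * (m : ℤ) = (k : ℤ) * (2 * n - 2) + n - 2 → ∀ z : ℤ,
      MB k (2 * (m : ℤ)) (ι m (2 * (m : ℤ)) z) = 0)
    :
    ∀ k : ℕ, 1 ≤ k → addOrderOf (eV k ((k : ℤ) * (2 * n - 2) + n) 1) = 2 * k + 1 := by
  intro k _
  have hd : 2 < 2 * n - 2 := by linarith
  have hdeven : ∀ l : ℕ, Even ((l : ℤ) * (2 * n - 2)) := fun l =>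
    Even.mul_left ⟨n - 1, by ring⟩ _
  have hinj : ∀ i : ℤ, Odd i → (∀ l : ℕ, i ≠ l * (2 * n - 2) + n - 1) →
      Function.Injective (c i (i - 2)) := fun i hi hB => by
    have hne : ∀ {m : ℤ}, Even m → i ≠ m := fun hm him => Int.not_even_iff_odd.mpr hi (him ▸ hm)
    exact hcinj i (fun l => hne ((hdeven l).add heven)) hB (hne Even.zero)
      (fun l _ => hne (hdeven l))
  have hvanish := odd_vanishing_of_gysin hd hneg eB MV c hexB hinj hexMV hBV
  have hzero : ∀ y : H (k * (2 * n - 2) + n - 3), y = 0 :=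
    hvanish _ (((hdeven k).add heven).sub_odd (by decide))
      fun l hl => mul_ne_mul_add_two hd k l (by linear_combination hl)
  have hrange : ∀ w : ℤ, w ∈ (MV k (k * (2 * n - 2) + n - 1)).range ↔ 2 * (k : ℤ) + 1 ∣ w := by
    intro w
    constructor
    · rintro ⟨x, rfl⟩
      obtain ⟨z, rfl⟩ : x ∈ (eB k (k * (2 * n - 2) + n - 1)).range := hexB k ▸ hzero _
      exact ⟨z, hBV k z⟩
    · rintro ⟨z, rfl⟩
      exact ⟨_, hBV k z⟩
  refine Nat.dvd_right_iff_eq.mp fun m => ?_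
  rw [addOrderOf_dvd_iff_nsmul_eq_zero, ← map_nsmul, ← AddMonoidHom.mem_ker, hkerV, hrange,
    nsmul_one, ← Int.natCast_dvd_natCast]
  push_cast
  rfl
end

section
/- For every integer k ≥ 1, the map e : ℍ_{k(2n−2)−n} = (ℤ/2ℤ)·(av^k) → H_{k(2n−2)} is injective; in particular e(av^k) is an element of order 2 in H_{k(2n−2)}, so the string homology of an even sphere contains 2-torsion in every degree k(2n−2), k ≥ 1. -/
/-- No two multiples of `d` differ by an integer strictly between `0` and `d`. -/
theorem mul_add_ne_mul_of_pos_of_lt {d s : ℤ} (hs : 0 < s) (hsd : s < d) (a b : ℤ) :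
    a * d + s ≠ b * d := by
  intro h
  have hd : 0 < d := hs.trans hsd
  have h1 : a < b := lt_of_mul_lt_mul_right (by linarith) hd.le
  have h2 : b < a + 1 := lt_of_mul_lt_mul_right (by linarith) hd.le
  omega


/-- For every `k ≥ 1`, the erasing map `e : ℍ_{k(2n-2)-n} = (ℤ/2ℤ)·(avᵏ) → H_{k(2n-2)}` is
injective; in particular `e(avᵏ)` is an element of order `2` in `H_{k(2n-2)}`, so the string
homology of an even sphere contains 2-torsion in every degree `k(2n-2)`, `k ≥ 1`. -/
theorem stmt14
    (n : ℤ) (heven : Even n) (hn4 : 4 ≤ n)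
    (H : ℤ → Type) [∀ i, AddCommGroup (H i)]
    -- H_i = 0 in negative degrees
    (hneg : ∀ i : ℤ, i < 0 → ∀ x : H i, x = 0)
    -- erasing maps on the pieces of ℍ = Λ(b)⊗ℤ[a,v]/(a²,ab,2av):
    -- `eV k` on ℤ·vᵏ (meaningful at degree k(2n-2)+n), `eB k` on ℤ·(bvᵏ) (at k(2n-2)+n-1),
    -- `ea` on ℤ·a (at degree 0), `eAV k` on (ℤ/2)·(avᵏ), k ≥ 1 (at degree k(2n-2))
    (eV : ℕ → ∀ i : ℤ, ℤ →+ H i)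
    (eB : ℕ → ∀ i : ℤ, ℤ →+ H i)
    (ea : ℤ →+ H 0)
    (eAV : ℕ → ∀ i : ℤ, ZMod 2 →+ H i)
    -- marking maps into the pieces of ℍ: `MV k` into ℤ·vᵏ (meaningful at degree k(2n-2)+n-1),
    -- `MB k` into ℤ·(bvᵏ) (at k(2n-2)+n-2), `MAV k` into (ℤ/2)·(avᵏ), k ≥ 1 (at k(2n-2)-1)
    (MV : ℕ → ∀ i : ℤ, H i →+ ℤ)
    (MB : ℕ → ∀ i : ℤ, H i →+ ℤ)
    (MAV : ℕ → ∀ i : ℤ, H i →+ ZMod 2)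
    -- cap product with the Euler class; c i j is only meaningful when j = i - 2
    (c : ∀ i j : ℤ, H i →+ H j)
    -- classes coming from H_*(ℂP^∞): ι m is meaningful at degree 2m
    (ι : ℕ → ∀ i : ℤ, ℤ →+ H i)
    -- exactness of ⋯ → ℍ_{i-n} →e→ H_i →c→ H_{i-2} →M→ ℍ_{i-n-1} →e→ H_{i-1} → ⋯ :
    (hexV : ∀ k : ℕ, AddMonoidHom.range (eV k ((k : ℤ) * (2 * n - 2) + n)) =
      AddMonoidHom.ker (c ((k : ℤ) * (2 * n - 2) + n) ((k : ℤ) * (2 * n - 2) + n - 2)))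
    (hexB : ∀ k : ℕ, AddMonoidHom.range (eB k ((k : ℤ) * (2 * n - 2) + n - 1)) =
      AddMonoidHom.ker (c ((k : ℤ) * (2 * n - 2) + n - 1) ((k : ℤ) * (2 * n - 2) + n - 3)))
    (hexa : AddMonoidHom.range ea = AddMonoidHom.ker (c 0 (-2)))
    (hexAV : ∀ k : ℕ, 1 ≤ k → AddMonoidHom.range (eAV k ((k : ℤ) * (2 * n - 2))) =
      AddMonoidHom.ker (c ((k : ℤ) * (2 * n - 2)) ((k : ℤ) * (2 * n - 2) - 2)))
    (hcinj : ∀ i : ℤ, (∀ k : ℕ, i ≠ (k : ℤ) * (2 * n - 2) + n) →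
      (∀ k : ℕ, i ≠ (k : ℤ) * (2 * n - 2) + n - 1) → i ≠ 0 →
      (∀ k : ℕ, 1 ≤ k → i ≠ (k : ℤ) * (2 * n - 2)) → Function.Injective (c i (i - 2)))
    (hexMV : ∀ k : ℕ,
      AddMonoidHom.range (c ((k : ℤ) * (2 * n - 2) + n + 1) ((k : ℤ) * (2 * n - 2) + n - 1)) =
      AddMonoidHom.ker (MV k ((k : ℤ) * (2 * n - 2) + n - 1)))
    (hexMB : ∀ k : ℕ,
      AddMonoidHom.range (c ((k : ℤ) * (2 * n - 2) + n) ((k : ℤ) * (2 * n - 2) + n - 2)) =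
      AddMonoidHom.ker (MB k ((k : ℤ) * (2 * n - 2) + n - 2)))
    (hexMAV : ∀ k : ℕ, 1 ≤ k →
      AddMonoidHom.range (c ((k : ℤ) * (2 * n - 2) + 1) ((k : ℤ) * (2 * n - 2) - 1)) =
      AddMonoidHom.ker (MAV k ((k : ℤ) * (2 * n - 2) - 1)))
    (hcsurj : ∀ i : ℤ, (∀ k : ℕ, i ≠ (k : ℤ) * (2 * n - 2) + n - 1) →
      (∀ k : ℕ, i ≠ (k : ℤ) * (2 * n - 2) + n - 2) →
      (∀ k : ℕ, 1 ≤ k → i ≠ (k : ℤ) * (2 * n - 2) - 1) → Function.Surjective (c (i + 2) i))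
    (hkerV : ∀ k : ℕ, AddMonoidHom.ker (eV k ((k : ℤ) * (2 * n - 2) + n)) =
      AddMonoidHom.range (MV k ((k : ℤ) * (2 * n - 2) + n - 1)))
    (hkerB : ∀ k : ℕ, AddMonoidHom.ker (eB k ((k : ℤ) * (2 * n - 2) + n - 1)) =
      AddMonoidHom.range (MB k ((k : ℤ) * (2 * n - 2) + n - 2)))
    (hkera : Function.Injective ea)
    (hkerAV : ∀ k : ℕ, 1 ≤ k → AddMonoidHom.ker (eAV k ((k : ℤ) * (2 * n - 2))) =
      AddMonoidHom.range (MAV k ((k : ℤ) * (2 * n - 2) - 1)))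
    -- BV operator: M ∘ e = Δ with Δ(vᵏ) = 0, Δ(avᵏ) = 0, Δ(bvᵏ) = (2k+1)·vᵏ
    -- (the composites M ∘ e corresponding to Δ(vᵏ) and Δ(avᵏ) land in zero groups)
    (hBV : ∀ k : ℕ, ∀ z : ℤ, MV k ((k : ℤ) * (2 * n - 2) + n - 1)
      (eB k ((k : ℤ) * (2 * n - 2) + n - 1) z) = (2 * (k : ℤ) + 1) * z)
    -- ι₀ is an isomorphism, c ∘ ι = ι (one degree down), M ∘ ι = 0
    (hι0 : Function.Bijective (ι 0 0))
    (hιc : ∀ m : ℕ, 1 ≤ m → ∀ z : ℤ,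
      c (2 * (m : ℤ)) (2 * (m : ℤ) - 2) (ι m (2 * (m : ℤ)) z) = ι (m - 1) (2 * (m : ℤ) - 2) z)
    (hιM : ∀ m k : ℕ, 2 * (m : ℤ) = (k : ℤ) * (2 * n - 2) + n - 2 → ∀ z : ℤ,
      MB k (2 * (m : ℤ)) (ι m (2 * (m : ℤ)) z) = 0)
    :
    ∀ k : ℕ, 1 ≤ k → Function.Injective (eAV k ((k : ℤ) * (2 * n - 2))) ∧
      addOrderOf (eAV k ((k : ℤ) * (2 * n - 2)) 1) = 2 := by
  have hinj {i j : ℤ} (hj : j = i - 2) (hi : Odd i)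
      (hB : ∀ k : ℕ, i ≠ (k : ℤ) * (2 * n - 2) + n - 1) : Function.Injective (c i j) := by
    subst hj
    have hev (k : ℕ) : Even ((k : ℤ) * (2 * n - 2)) :=
      Even.mul_left ((even_two_mul n).sub even_two) _
    refine hcinj i (fun k h => ?_) hB (fun h => ?_) fun k _ h => ?_
    · exact Int.not_even_iff_odd.2 hi (h ▸ (hev k).add heven)
    · exact Int.not_even_iff_odd.2 hi (h ▸ Even.zero)
    · exact Int.not_even_iff_odd.2 hi (h ▸ hev k)
  -- the odd string homology is concentrated in the degrees of the classes `bvᵏ`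
  have hodd (m : ℕ) : ∀ i : ℤ, i < m → Odd i →
      (∀ k : ℕ, i ≠ (k : ℤ) * (2 * n - 2) + n - 1) → ∀ x : H i, x = 0 := by
    induction m with
    | zero => exact fun i hi _ _ => hneg i (by simpa using hi)
    | succ m ih =>
      intro i hi hio hiB x
      by_cases hB : ∃ k : ℕ, i = (k : ℤ) * (2 * n - 2) + n + 1
      · obtain ⟨k, rfl⟩ := hB
        refine (injective_iff_map_eq_zero _).1
          (hinj (j := (k : ℤ) * (2 * n - 2) + n - 1) (by ring) hio hiB) x ?_
        set y := c _ ((k : ℤ) * (2 * n - 2) + n - 1) x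
        have hMy : MV k _ y = 0 := by
          rw [← AddMonoidHom.mem_ker, ← hexMV]
          exact ⟨x, rfl⟩
        have hcy : c _ ((k : ℤ) * (2 * n - 2) + n - 3) y = 0 := by
          refine ih _ (by push_cast at hi; linarith) ?_ (fun l h => ?_) _
          · rw [show (k : ℤ) * (2 * n - 2) + n - 3 = (k : ℤ) * (2 * n - 2) + n + 1 - 4 by ring]
            exact hio.sub_even (by decide)
          · exact mul_add_ne_mul_of_pos_of_lt (d := 2 * n - 2) (s := 2) two_pos (by linarith) l k
              (by linarith)
        rw [← AddMonoidHom.mem_ker, ← hexB] at hcy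
        obtain ⟨z, hz⟩ := hcy
        rw [← hz, hBV] at hMy
        have hz0 : z = 0 := (mul_eq_zero.1 hMy).resolve_left (by positivity)
        rw [← hz, hz0, map_zero]
      · push Not at hB
        refine (injective_iff_map_eq_zero _).1 (hinj rfl hio hiB) x
          (ih _ (by push_cast at hi; linarith) (hio.sub_even even_two) (fun k h => ?_) _)
        exact hB k (by linarith)
  intro k hk
  have hH : ∀ x : H ((k : ℤ) * (2 * n - 2) - 1), x = 0 := by
    refine hodd ((k : ℤ) * (2 * n - 2)).toNat _ ?_ ?_ fun l h => ?_
    · have := Int.self_le_toNat ((k : ℤ) * (2 * n - 2))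
      linarith
    · exact (Even.mul_left ((even_two_mul n).sub even_two) _).sub_odd odd_one
    · exact mul_add_ne_mul_of_pos_of_lt (d := 2 * n - 2) (s := n) (by linarith) (by linarith) l k
        (by linarith)
  have hAV : Function.Injective (eAV k ((k : ℤ) * (2 * n - 2))) := by
    rw [← AddMonoidHom.ker_eq_bot_iff, hkerAV k hk, eq_bot_iff]
    rintro _ ⟨x, rfl⟩
    simp [hH x]
  exact ⟨hAV, by rw [addOrderOf_injective _ hAV, ZMod.addOrderOf_one]⟩
end

section
/- For all integers k, l ≥ 0 one has the string bracket formula [e(bv^k), e(bv^l)] = −(2k+1)(2l+1)·e(v^{k+l}) = −(4kl+2k+2l+1)·e(v^{k+l}) in H_{(k+l)(2n−2)+n}, and this bracket is zero if and only if (2(k+l)+1) divides (2k+1)(2l+1); in particular the string bracket of an even sphere is not identically zero on torsion classes (Theorem 3.2(3)). -/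
/-- Two degrees of the form `k(2n-2)+n-1` never differ by `2`. -/
theorem degree_sub_two_ne {n : ℤ} (hn4 : 4 ≤ n) (k l : ℕ) :
    (k : ℤ) * (2 * n - 2) + n - 3 ≠ (l : ℤ) * (2 * n - 2) + n - 1 := by
  intro h
  have h' : ((k : ℤ) - l) * (n - 1) = 1 := by linarith
  have := Int.isUnit_iff.mp (IsUnit.of_mul_eq_one_right _ h')
  omega

/-- The odd-degree part of the Gysin sequence of an even sphere: the string homology vanishes in odd
degrees other than `k(2n-2)+n-1`, by descent along the injective cap products. -/
theorem odd_string_homology_eq_zero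
    {n : ℤ} (hn4 : 4 ≤ n)
    {H : ℤ → Type} [∀ i, AddCommGroup (H i)]
    (hneg : ∀ i : ℤ, i < 0 → ∀ x : H i, x = 0)
    {eB : ℕ → ∀ i : ℤ, ℤ →+ H i} {MV : ℕ → ∀ i : ℤ, H i →+ ℤ} {c : ∀ i j : ℤ, H i →+ H j}
    (hexB : ∀ k : ℕ, AddMonoidHom.range (eB k ((k : ℤ) * (2 * n - 2) + n - 1)) =
      AddMonoidHom.ker (c ((k : ℤ) * (2 * n - 2) + n - 1) ((k : ℤ) * (2 * n - 2) + n - 3)))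
    (hexMV : ∀ k : ℕ,
      AddMonoidHom.range (c ((k : ℤ) * (2 * n - 2) + n + 1) ((k : ℤ) * (2 * n - 2) + n - 1)) =
      AddMonoidHom.ker (MV k ((k : ℤ) * (2 * n - 2) + n - 1)))
    (hcinj : ∀ i : ℤ, Odd i → (∀ k : ℕ, i ≠ (k : ℤ) * (2 * n - 2) + n - 1) →
      Function.Injective (c i (i - 2)))
    (hBV : ∀ k : ℕ, ∀ z : ℤ, MV k ((k : ℤ) * (2 * n - 2) + n - 1)
      (eB k ((k : ℤ) * (2 * n - 2) + n - 1) z) = (2 * (k : ℤ) + 1) * z)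
    (i : ℤ) (hi : Odd i) (hne : ∀ k : ℕ, i ≠ (k : ℤ) * (2 * n - 2) + n - 1) (x : H i) :
    x = 0 := by
  have key (m : ℕ) : ∀ i : ℤ, i < m → Odd i →
      (∀ k : ℕ, i ≠ (k : ℤ) * (2 * n - 2) + n - 1) → ∀ x : H i, x = 0 := by
    induction m with
    | zero => exact fun i hi _ _ => hneg i (by simpa using hi)
    | succ m ih =>
      intro i him hi hne x
      push_cast at him
      have inj (j : ℤ) (hj : j = i - 2) : Function.Injective (c i j) := by
        subst hj
        exact hcinj i hi hne
      by_cases h : ∃ k : ℕ, i = (k : ℤ) * (2 * n - 2) + n + 1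
      · obtain ⟨k, rfl⟩ := h
        apply inj ((k : ℤ) * (2 * n - 2) + n - 1) (by ring)
        rw [map_zero]
        set y := c ((k : ℤ) * (2 * n - 2) + n + 1) ((k : ℤ) * (2 * n - 2) + n - 1) x
        have hyM : MV k _ y = 0 := by
          have : y ∈ AddMonoidHom.ker (MV k ((k : ℤ) * (2 * n - 2) + n - 1)) :=
            hexMV k ▸ ⟨x, rfl⟩
          exact this
        have hyB : y ∈ AddMonoidHom.range (eB k ((k : ℤ) * (2 * n - 2) + n - 1)) := by
          rw [hexB k, AddMonoidHom.mem_ker]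
          apply ih
          · linarith
          · have := hi.sub_even (by decide : Even (4 : ℤ))
            rwa [add_sub_assoc, show (1 : ℤ) - 4 = -3 by norm_num, ← sub_eq_add_neg] at this
          · exact degree_sub_two_ne hn4 k
        obtain ⟨z, hz⟩ := hyB
        rw [← hz, hBV] at hyM
        have hz0 : z = 0 := (mul_eq_zero.mp hyM).resolve_left (by omega)
        rw [← hz, hz0, map_zero]
      · apply inj (i - 2) rfl
        rw [map_zero]
        apply ih
        · linarith
        · exact hi.sub_even (by decide)
        · exact fun k hk => h ⟨k, by linarith⟩
  exact key (i.toNat + 1) i (by omega) hi hne x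

/-- String bracket of an even sphere (Theorem 3.2(3)): for `k, l ≥ 0`,
`[e(bvᵏ), e(bvˡ)] = (-1)^{(k(2n-2)+n-1)-n}·e(M(e(bvᵏ))•M(e(bvˡ)))
 = -(2k+1)(2l+1)·e(v^{k+l}) = -(4kl+2k+2l+1)·e(v^{k+l})` in `H_{(k+l)(2n-2)+n}`,
and this bracket is zero iff `(2(k+l)+1) ∣ (2k+1)(2l+1)`; in particular it is not
identically zero. Here `M(e(bvᵏ)) ∈ ℍ_{k(2n-2)} = ℤ·vᵏ` and the loop product multiplies
coefficients: `vᵏ•vˡ = v^{k+l}`. -/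
theorem stmt15
    (n : ℤ) (heven : Even n) (hn4 : 4 ≤ n)
    (H : ℤ → Type) [∀ i, AddCommGroup (H i)]
    -- H_i = 0 in negative degrees
    (hneg : ∀ i : ℤ, i < 0 → ∀ x : H i, x = 0)
    -- erasing maps on the pieces of ℍ = Λ(b)⊗ℤ[a,v]/(a²,ab,2av):
    -- `eV k` on ℤ·vᵏ (meaningful at degree k(2n-2)+n), `eB k` on ℤ·(bvᵏ) (at k(2n-2)+n-1),
    -- `ea` on ℤ·a (at degree 0), `eAV k` on (ℤ/2)·(avᵏ), k ≥ 1 (at degree k(2n-2))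
    (eV : ℕ → ∀ i : ℤ, ℤ →+ H i)
    (eB : ℕ → ∀ i : ℤ, ℤ →+ H i)
    (ea : ℤ →+ H 0)
    (eAV : ℕ → ∀ i : ℤ, ZMod 2 →+ H i)
    -- marking maps into the pieces of ℍ: `MV k` into ℤ·vᵏ (meaningful at degree k(2n-2)+n-1),
    -- `MB k` into ℤ·(bvᵏ) (at k(2n-2)+n-2), `MAV k` into (ℤ/2)·(avᵏ), k ≥ 1 (at k(2n-2)-1)
    (MV : ℕ → ∀ i : ℤ, H i →+ ℤ)
    (MB : ℕ → ∀ i : ℤ, H i →+ ℤ)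
    (MAV : ℕ → ∀ i : ℤ, H i →+ ZMod 2)
    -- cap product with the Euler class; c i j is only meaningful when j = i - 2
    (c : ∀ i j : ℤ, H i →+ H j)
    -- classes coming from H_*(ℂP^∞): ι m is meaningful at degree 2m
    (ι : ℕ → ∀ i : ℤ, ℤ →+ H i)
    -- exactness of ⋯ → ℍ_{i-n} →e→ H_i →c→ H_{i-2} →M→ ℍ_{i-n-1} →e→ H_{i-1} → ⋯ :
    (hexV : ∀ k : ℕ, AddMonoidHom.range (eV k ((k : ℤ) * (2 * n - 2) + n)) =
      AddMonoidHom.ker (c ((k : ℤ) * (2 * n - 2) + n) ((k : ℤ) * (2 * n - 2) + n - 2)))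
    (hexB : ∀ k : ℕ, AddMonoidHom.range (eB k ((k : ℤ) * (2 * n - 2) + n - 1)) =
      AddMonoidHom.ker (c ((k : ℤ) * (2 * n - 2) + n - 1) ((k : ℤ) * (2 * n - 2) + n - 3)))
    (hexa : AddMonoidHom.range ea = AddMonoidHom.ker (c 0 (-2)))
    (hexAV : ∀ k : ℕ, 1 ≤ k → AddMonoidHom.range (eAV k ((k : ℤ) * (2 * n - 2))) =
      AddMonoidHom.ker (c ((k : ℤ) * (2 * n - 2)) ((k : ℤ) * (2 * n - 2) - 2)))
    (hcinj : ∀ i : ℤ, (∀ k : ℕ, i ≠ (k : ℤ) * (2 * n - 2) + n) →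
      (∀ k : ℕ, i ≠ (k : ℤ) * (2 * n - 2) + n - 1) → i ≠ 0 →
      (∀ k : ℕ, 1 ≤ k → i ≠ (k : ℤ) * (2 * n - 2)) → Function.Injective (c i (i - 2)))
    (hexMV : ∀ k : ℕ,
      AddMonoidHom.range (c ((k : ℤ) * (2 * n - 2) + n + 1) ((k : ℤ) * (2 * n - 2) + n - 1)) =
      AddMonoidHom.ker (MV k ((k : ℤ) * (2 * n - 2) + n - 1)))
    (hexMB : ∀ k : ℕ,
      AddMonoidHom.range (c ((k : ℤ) * (2 * n - 2) + n) ((k : ℤ) * (2 * n - 2) + n - 2)) =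
      AddMonoidHom.ker (MB k ((k : ℤ) * (2 * n - 2) + n - 2)))
    (hexMAV : ∀ k : ℕ, 1 ≤ k →
      AddMonoidHom.range (c ((k : ℤ) * (2 * n - 2) + 1) ((k : ℤ) * (2 * n - 2) - 1)) =
      AddMonoidHom.ker (MAV k ((k : ℤ) * (2 * n - 2) - 1)))
    (hcsurj : ∀ i : ℤ, (∀ k : ℕ, i ≠ (k : ℤ) * (2 * n - 2) + n - 1) →
      (∀ k : ℕ, i ≠ (k : ℤ) * (2 * n - 2) + n - 2) →
      (∀ k : ℕ, 1 ≤ k → i ≠ (k : ℤ) * (2 * n - 2) - 1) → Function.Surjective (c (i + 2) i))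
    (hkerV : ∀ k : ℕ, AddMonoidHom.ker (eV k ((k : ℤ) * (2 * n - 2) + n)) =
      AddMonoidHom.range (MV k ((k : ℤ) * (2 * n - 2) + n - 1)))
    (hkerB : ∀ k : ℕ, AddMonoidHom.ker (eB k ((k : ℤ) * (2 * n - 2) + n - 1)) =
      AddMonoidHom.range (MB k ((k : ℤ) * (2 * n - 2) + n - 2)))
    (hkera : Function.Injective ea)
    (hkerAV : ∀ k : ℕ, 1 ≤ k → AddMonoidHom.ker (eAV k ((k : ℤ) * (2 * n - 2))) =
      AddMonoidHom.range (MAV k ((k : ℤ) * (2 * n - 2) - 1)))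
    -- BV operator: M ∘ e = Δ with Δ(vᵏ) = 0, Δ(avᵏ) = 0, Δ(bvᵏ) = (2k+1)·vᵏ
    -- (the composites M ∘ e corresponding to Δ(vᵏ) and Δ(avᵏ) land in zero groups)
    (hBV : ∀ k : ℕ, ∀ z : ℤ, MV k ((k : ℤ) * (2 * n - 2) + n - 1)
      (eB k ((k : ℤ) * (2 * n - 2) + n - 1) z) = (2 * (k : ℤ) + 1) * z)
    -- ι₀ is an isomorphism, c ∘ ι = ι (one degree down), M ∘ ι = 0
    (hι0 : Function.Bijective (ι 0 0))
    (hιc : ∀ m : ℕ, 1 ≤ m → ∀ z : ℤ,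
      c (2 * (m : ℤ)) (2 * (m : ℤ) - 2) (ι m (2 * (m : ℤ)) z) = ι (m - 1) (2 * (m : ℤ) - 2) z)
    (hιM : ∀ m k : ℕ, 2 * (m : ℤ) = (k : ℤ) * (2 * n - 2) + n - 2 → ∀ z : ℤ,
      MB k (2 * (m : ℤ)) (ι m (2 * (m : ℤ)) z) = 0)
    :
    ∀ k l : ℕ,
      ((((-1 : ℤˣ) ^ (((k : ℤ) * (2 * n - 2) + n - 1) - n) : ℤˣ) : ℤ) •
          eV (k + l) (((k + l : ℕ) : ℤ) * (2 * n - 2) + n)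
            (MV k ((k : ℤ) * (2 * n - 2) + n - 1) (eB k ((k : ℤ) * (2 * n - 2) + n - 1) 1) *
              MV l ((l : ℤ) * (2 * n - 2) + n - 1) (eB l ((l : ℤ) * (2 * n - 2) + n - 1) 1))
        = (-((2 * (k : ℤ) + 1) * (2 * (l : ℤ) + 1))) •
            eV (k + l) (((k + l : ℕ) : ℤ) * (2 * n - 2) + n) 1) ∧
      ((-((2 * (k : ℤ) + 1) * (2 * (l : ℤ) + 1))) •
          eV (k + l) (((k + l : ℕ) : ℤ) * (2 * n - 2) + n) 1
        = (-(4 * (k : ℤ) * (l : ℤ) + 2 * (k : ℤ) + 2 * (l : ℤ) + 1)) •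
            eV (k + l) (((k + l : ℕ) : ℤ) * (2 * n - 2) + n) 1) ∧
      ((-((2 * (k : ℤ) + 1) * (2 * (l : ℤ) + 1))) •
          eV (k + l) (((k + l : ℕ) : ℤ) * (2 * n - 2) + n) 1 = 0 ↔
        (2 * ((k : ℤ) + (l : ℤ)) + 1) ∣ ((2 * (k : ℤ) + 1) * (2 * (l : ℤ) + 1))) := by
  have hodd (k : ℕ) : Odd ((k : ℤ) * (2 * n - 2) + n - 1) :=
    ((((even_two_mul n).sub even_two).mul_left _).add heven).sub_odd odd_one
  have hvanish := odd_string_homology_eq_zero hn4 hneg hexB hexMV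
    (fun i hi h => hcinj i
      (fun k hk => by
        have := hodd k
        rw [← hk] at this
        exact Int.not_even_iff_odd.mpr hi (by simpa using this.add_one))
      h
      (by rintro rfl; simp at hi)
      (fun k _ hk => Int.not_even_iff_odd.mpr hi
        (hk ▸ ((even_two_mul n).sub even_two).mul_left _)))
    hBV
  have hrange (k : ℕ) (y : H ((k : ℤ) * (2 * n - 2) + n - 1)) :
      y ∈ AddMonoidHom.range (eB k ((k : ℤ) * (2 * n - 2) + n - 1)) := by
    rw [hexB k, AddMonoidHom.mem_ker]
    apply hvanish
    · have := (hodd k).sub_even even_two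
      rwa [sub_sub, show (1 : ℤ) + 2 = 3 by norm_num] at this
    · exact degree_sub_two_ne hn4 k
  have heV (k : ℕ) (z : ℤ) :
      eV k ((k : ℤ) * (2 * n - 2) + n) z = 0 ↔ (2 * (k : ℤ) + 1) ∣ z := by
    rw [← AddMonoidHom.mem_ker, hkerV k]
    constructor
    · rintro ⟨y, rfl⟩
      obtain ⟨w, rfl⟩ := hrange k y
      exact ⟨w, hBV k w⟩
    · rintro ⟨w, rfl⟩
      exact ⟨_, hBV k w⟩
  intro k l
  refine ⟨?_, ?_, ?_⟩
  · have hsign : Odd ((k : ℤ) * (2 * n - 2) + n - 1 - n) := (hodd k).sub_even heven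
    rw [hsign.neg_one_zpow, hBV, hBV, ← map_zsmul, ← map_zsmul]
    simp
  · congr 1
    ring
  · rw [← map_zsmul, heV]
    push_cast
    rw [smul_eq_mul, mul_one, dvd_neg]
end

section
/- If α ∈ H_p with p even, then M_p(α) = 0, and consequently [α, β] = 0 for every q and every β ∈ H_q; that is, for even spheres the string bracket vanishes whenever one of its arguments has even degree, so the only possibly nonzero brackets are between the odd-degree classes e(bv^k). -/
/-- For even spheres the string bracket vanishes when one argument has even degree:
the marking map kills every class of even degree (the only even degrees where `M` can be
nonzero are `k(2n-2)+n-2`, into `ℤ·(bvᵏ)`), and consequently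
`[α,β] = (-1)^{p-n}·e(M(α)•M(β)) = 0` for `α` of even degree `p = k(2n-2)+n-2` and any `β`
(for `β` of degree `l(2n-2)+n-1` the product `M(α)•M(β)` lies in `ℤ·(bv^{k+l})` and is erased
by `eB (k+l)`; all other configurations are zero already in `ℍ`). -/
theorem stmt16
    (n : ℤ) (heven : Even n) (hn4 : 4 ≤ n)
    (H : ℤ → Type) [∀ i, AddCommGroup (H i)]
    -- H_i = 0 in negative degrees
    (hneg : ∀ i : ℤ, i < 0 → ∀ x : H i, x = 0)
    -- erasing maps on the pieces of ℍ = Λ(b)⊗ℤ[a,v]/(a²,ab,2av):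
    -- `eV k` on ℤ·vᵏ (meaningful at degree k(2n-2)+n), `eB k` on ℤ·(bvᵏ) (at k(2n-2)+n-1),
    -- `ea` on ℤ·a (at degree 0), `eAV k` on (ℤ/2)·(avᵏ), k ≥ 1 (at degree k(2n-2))
    (eV : ℕ → ∀ i : ℤ, ℤ →+ H i)
    (eB : ℕ → ∀ i : ℤ, ℤ →+ H i)
    (ea : ℤ →+ H 0)
    (eAV : ℕ → ∀ i : ℤ, ZMod 2 →+ H i)
    -- marking maps into the pieces of ℍ: `MV k` into ℤ·vᵏ (meaningful at degree k(2n-2)+n-1),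
    -- `MB k` into ℤ·(bvᵏ) (at k(2n-2)+n-2), `MAV k` into (ℤ/2)·(avᵏ), k ≥ 1 (at k(2n-2)-1)
    (MV : ℕ → ∀ i : ℤ, H i →+ ℤ)
    (MB : ℕ → ∀ i : ℤ, H i →+ ℤ)
    (MAV : ℕ → ∀ i : ℤ, H i →+ ZMod 2)
    -- cap product with the Euler class; c i j is only meaningful when j = i - 2
    (c : ∀ i j : ℤ, H i →+ H j)
    -- classes coming from H_*(ℂP^∞): ι m is meaningful at degree 2m
    (ι : ℕ → ∀ i : ℤ, ℤ →+ H i)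
    -- exactness of ⋯ → ℍ_{i-n} →e→ H_i →c→ H_{i-2} →M→ ℍ_{i-n-1} →e→ H_{i-1} → ⋯ :
    (hexV : ∀ k : ℕ, AddMonoidHom.range (eV k ((k : ℤ) * (2 * n - 2) + n)) =
      AddMonoidHom.ker (c ((k : ℤ) * (2 * n - 2) + n) ((k : ℤ) * (2 * n - 2) + n - 2)))
    (hexB : ∀ k : ℕ, AddMonoidHom.range (eB k ((k : ℤ) * (2 * n - 2) + n - 1)) =
      AddMonoidHom.ker (c ((k : ℤ) * (2 * n - 2) + n - 1) ((k : ℤ) * (2 * n - 2) + n - 3)))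
    (hexa : AddMonoidHom.range ea = AddMonoidHom.ker (c 0 (-2)))
    (hexAV : ∀ k : ℕ, 1 ≤ k → AddMonoidHom.range (eAV k ((k : ℤ) * (2 * n - 2))) =
      AddMonoidHom.ker (c ((k : ℤ) * (2 * n - 2)) ((k : ℤ) * (2 * n - 2) - 2)))
    (hcinj : ∀ i : ℤ, (∀ k : ℕ, i ≠ (k : ℤ) * (2 * n - 2) + n) →
      (∀ k : ℕ, i ≠ (k : ℤ) * (2 * n - 2) + n - 1) → i ≠ 0 →
      (∀ k : ℕ, 1 ≤ k → i ≠ (k : ℤ) * (2 * n - 2)) → Function.Injective (c i (i - 2)))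
    (hexMV : ∀ k : ℕ,
      AddMonoidHom.range (c ((k : ℤ) * (2 * n - 2) + n + 1) ((k : ℤ) * (2 * n - 2) + n - 1)) =
      AddMonoidHom.ker (MV k ((k : ℤ) * (2 * n - 2) + n - 1)))
    (hexMB : ∀ k : ℕ,
      AddMonoidHom.range (c ((k : ℤ) * (2 * n - 2) + n) ((k : ℤ) * (2 * n - 2) + n - 2)) =
      AddMonoidHom.ker (MB k ((k : ℤ) * (2 * n - 2) + n - 2)))
    (hexMAV : ∀ k : ℕ, 1 ≤ k →
      AddMonoidHom.range (c ((k : ℤ) * (2 * n - 2) + 1) ((k : ℤ) * (2 * n - 2) - 1)) =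
      AddMonoidHom.ker (MAV k ((k : ℤ) * (2 * n - 2) - 1)))
    (hcsurj : ∀ i : ℤ, (∀ k : ℕ, i ≠ (k : ℤ) * (2 * n - 2) + n - 1) →
      (∀ k : ℕ, i ≠ (k : ℤ) * (2 * n - 2) + n - 2) →
      (∀ k : ℕ, 1 ≤ k → i ≠ (k : ℤ) * (2 * n - 2) - 1) → Function.Surjective (c (i + 2) i))
    (hkerV : ∀ k : ℕ, AddMonoidHom.ker (eV k ((k : ℤ) * (2 * n - 2) + n)) =
      AddMonoidHom.range (MV k ((k : ℤ) * (2 * n - 2) + n - 1)))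
    (hkerB : ∀ k : ℕ, AddMonoidHom.ker (eB k ((k : ℤ) * (2 * n - 2) + n - 1)) =
      AddMonoidHom.range (MB k ((k : ℤ) * (2 * n - 2) + n - 2)))
    (hkera : Function.Injective ea)
    (hkerAV : ∀ k : ℕ, 1 ≤ k → AddMonoidHom.ker (eAV k ((k : ℤ) * (2 * n - 2))) =
      AddMonoidHom.range (MAV k ((k : ℤ) * (2 * n - 2) - 1)))
    -- BV operator: M ∘ e = Δ with Δ(vᵏ) = 0, Δ(avᵏ) = 0, Δ(bvᵏ) = (2k+1)·vᵏ
    -- (the composites M ∘ e corresponding to Δ(vᵏ) and Δ(avᵏ) land in zero groups)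
    (hBV : ∀ k : ℕ, ∀ z : ℤ, MV k ((k : ℤ) * (2 * n - 2) + n - 1)
      (eB k ((k : ℤ) * (2 * n - 2) + n - 1) z) = (2 * (k : ℤ) + 1) * z)
    -- ι₀ is an isomorphism, c ∘ ι = ι (one degree down), M ∘ ι = 0
    (hι0 : Function.Bijective (ι 0 0))
    (hιc : ∀ m : ℕ, 1 ≤ m → ∀ z : ℤ,
      c (2 * (m : ℤ)) (2 * (m : ℤ) - 2) (ι m (2 * (m : ℤ)) z) = ι (m - 1) (2 * (m : ℤ) - 2) z)
    (hιM : ∀ m k : ℕ, 2 * (m : ℤ) = (k : ℤ) * (2 * n - 2) + n - 2 → ∀ z : ℤ,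
      MB k (2 * (m : ℤ)) (ι m (2 * (m : ℤ)) z) = 0)
    :
    (∀ k : ℕ, ∀ α : H ((k : ℤ) * (2 * n - 2) + n - 2),
      MB k ((k : ℤ) * (2 * n - 2) + n - 2) α = 0) ∧
      (∀ k l : ℕ, ∀ α : H ((k : ℤ) * (2 * n - 2) + n - 2),
        ∀ β : H ((l : ℤ) * (2 * n - 2) + n - 1),
        (((-1 : ℤˣ) ^ (((k : ℤ) * (2 * n - 2) + n - 2) - n) : ℤˣ) : ℤ) •
          eB (k + l) (((k + l : ℕ) : ℤ) * (2 * n - 2) + n - 1)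
            (MB k ((k : ℤ) * (2 * n - 2) + n - 2) α *
              MV l ((l : ℤ) * (2 * n - 2) + n - 1) β) = 0) := by
  have hMB : ∀ k : ℕ, ∀ α : H ((k : ℤ) * (2 * n - 2) + n - 2),
      MB k ((k : ℤ) * (2 * n - 2) + n - 2) α = 0 := by
    intro k α
    have he : MB k _ α ∈ AddMonoidHom.ker (eB k ((k : ℤ) * (2 * n - 2) + n - 1)) :=
      hkerB k ▸ ⟨α, rfl⟩
    have hΔ := hBV k (MB k _ α)
    rw [AddMonoidHom.mem_ker.mp he, map_zero] at hΔ
    exact (mul_eq_zero.mp hΔ.symm).resolve_left (by omega)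
  refine ⟨hMB, fun k l α β => ?_⟩
  rw [hMB k α, zero_mul, map_zero, smul_zero]
end
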